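/- There exist constants c₁, c₂ > 0 and R ∈ ℕ such that for every integer n ≥ 1 there exists a multiple temperature tile system with tile complexity at most c₁, temperature range at most R, and temperature complexity at most c₂ · (log₂ n + 1) that uniquely assembles the n × n square. -/

import Mathlib

/-! ## The multiple temperature tile self-assembly model -/

/-- Glues are drawn from a countable alphabet; glue `0` is the distinguished `null` glue. -/
abbrev Glue := ℕ

/-- A tile is a quadruple of glues (north, east, south, west). -/
structure Tile where
  north : Glue
  east : Glue
  south : Glue
  west : Glue
deriving DecidableEq

/-- A configuration maps positions of `ℤ²` to a tile or to `none` (the empty tile). -/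
abbrev Config := ℤ × ℤ → Option Tile

/-- Two abutting edges bond with strength `G x` when they carry the same glue `x`,
and with strength `0` otherwise. -/
def bond (G : Glue → ℕ) (x y : Glue) : ℕ := if x = y then G x else 0

/-- Bonding strength between the edges of tile `t` at position `p` and tile `u`
at (neighboring) position `q`. -/
def edgeBond (G : Glue → ℕ) (t u : Tile) (p q : ℤ × ℤ) : ℕ :=
  if q = (p.1, p.2 + 1) then bond G t.north u.south
  else if q = (p.1 + 1, p.2) then bond G t.east u.west
  else if q = (p.1, p.2 - 1) then bond G t.south u.north
  else if q = (p.1 - 1, p.2) then bond G t.west u.east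
  else 0

/-- The four L¹-neighbors of a position. -/
def neighbors (p : ℤ × ℤ) : List (ℤ × ℤ) :=
  [(p.1, p.2 + 1), (p.1 + 1, p.2), (p.1, p.2 - 1), (p.1 - 1, p.2)]

/-- The shape of a configuration: its set of non-empty positions. -/
def shape (C : Config) : Set (ℤ × ℤ) := {p | C p ≠ none}

/-- Total bonding strength between a tile `t` placed at position `p` and the tiles of `C`
at the four neighboring positions. -/
def attachStrength (G : Glue → ℕ) (C : Config) (t : Tile) (p : ℤ × ℤ) : ℕ :=
  ((neighbors p).map (fun q =>
    match C q with
    | some u => edgeBond G t u p q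
    | none => 0)).sum

/-- Bonding strength between the tiles of `C` at adjacent positions `p` and `q`. -/
def bondAt (G : Glue → ℕ) (C : Config) (p q : ℤ × ℤ) : ℕ :=
  match C p, C q with
  | some t, some u => edgeBond G t u p q
  | _, _ => 0

/-- Total strength of the bonds from `p ∈ Q` leaving the set `Q` in configuration `C`. -/
def outStrength (G : Glue → ℕ) (C : Config) (Q : Finset (ℤ × ℤ)) (p : ℤ × ℤ) : ℕ :=
  (((neighbors p).filter (fun q => q ∉ Q)).map (fun q => bondAt G C p q)).sum

/-- Strength of the cut of (the adjacency graph of) `C` separating `Q` from its complement: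
the sum over crossing edges of the bonding strengths of the corresponding abutting edges. -/
def cutStrength (G : Glue → ℕ) (C : Config) (Q : Finset (ℤ × ℤ)) : ℕ :=
  ∑ p ∈ Q, outStrength G C Q p

/-- The initial configuration: the seed tile `s` at the origin. -/
def seedConfig (s : Tile) : Config := fun p => if p = (0, 0) then some s else none

/-- One step of assembly of the (standard) multiple temperature model at temperature `τ`:
either a tile of `T` attaches at an empty position with total bonding strength at least `τ`,
or the portion `Q` of the supertile on the non-seed side of a cut of strength `< τ`
is removed. -/
inductive Step (T : Finset Tile) (G : Glue → ℕ) (τ : ℕ) : Config → Config → Prop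
  | attach (C : Config) (t : Tile) (p : ℤ × ℤ) :
      t ∈ T → C p = none → τ ≤ attachStrength G C t p →
      Step T G τ C (Function.update C p (some t))
  | detach (C : Config) (Q : Finset (ℤ × ℤ)) :
      Q.Nonempty → ((0, 0) : ℤ × ℤ) ∉ Q → (↑Q : Set (ℤ × ℤ)) ⊆ shape C →
      cutStrength G C Q < τ →
      Step T G τ C (fun q => if q ∈ Q then none else C q)

/-- A configuration is terminal for a step relation if no step applies. -/
def Terminal (step : Config → Config → Prop) (C : Config) : Prop := ∀ D, ¬ step C D

/-- A phase finishes from `C`: there is no infinite sequence of steps starting at `C`. -/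
def PhaseTerminates (step : Config → Config → Prop) (C : Config) : Prop :=
  ¬ ∃ f : ℕ → Config, f 0 = C ∧ ∀ n, step (f n) (f (n + 1))

/-- `MultiReach step τs C E`: starting from `C`, running each phase (one per temperature
in `τs`) to a terminal configuration can produce `E`. -/
inductive MultiReach (step : ℕ → Config → Config → Prop) : List ℕ → Config → Config → Prop
  | nil {C : Config} : MultiReach step [] C C
  | cons {τ : ℕ} {τs : List ℕ} {C D E : Config} :
      Relation.ReflTransGen (step τ) C D → Terminal (step τ) D →
      MultiReach step τs D E → MultiReach step (τ :: τs) C E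

/-- Every phase finishes, no matter which additions and removals are chosen. -/
inductive AllFinish (step : ℕ → Config → Config → Prop) : List ℕ → Config → Prop
  | nil {C : Config} : AllFinish step [] C
  | cons {τ : ℕ} {τs : List ℕ} {C : Config} :
      PhaseTerminates (step τ) C →
      (∀ D, Relation.ReflTransGen (step τ) C D → Terminal (step τ) D → AllFinish step τs D) →
      AllFinish step (τ :: τs) C

/-- The tile system with seed `s` and temperature sequence `τs` uniquely produces the
configuration (supertile) `R`: all phases always finish, and every terminal configuration
produced after the last phase equals `R`. -/
def UniquelyProduces (step : ℕ → Config → Config → Prop) (s : Tile) (τs : List ℕ)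
    (R : Config) : Prop :=
  AllFinish step τs (seedConfig s) ∧
  MultiReach step τs (seedConfig s) R ∧
  ∀ C, MultiReach step τs (seedConfig s) C → C = R

/-- Translation of a set of positions by `d`. -/
def translateSet (d : ℤ × ℤ) (S : Set (ℤ × ℤ)) : Set (ℤ × ℤ) := (fun p => p + d) '' S

/-- The system uniquely assembles the shape `Υ` (up to translation). -/
def UniquelyAssembles (step : ℕ → Config → Config → Prop) (s : Tile) (τs : List ℕ)
    (Υ : Set (ℤ × ℤ)) : Prop :=
  ∃ R : Config, UniquelyProduces step s τs R ∧ ∃ d : ℤ × ℤ, shape R = translateSet d Υ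

/-- The `n × n` square shape `{0,…,n−1} × {0,…,n−1}`. -/
def square (n : ℕ) : Set (ℤ × ℤ) :=
  {p : ℤ × ℤ | 0 ≤ p.1 ∧ p.1 < (n : ℤ) ∧ 0 ≤ p.2 ∧ p.2 < (n : ℤ)}

/-- The `a × b` rectangle shape `{0,…,b−1} × {0,…,a−1}` (`b` columns, `a` rows). -/
def rect (a b : ℕ) : Set (ℤ × ℤ) :=
  {p : ℤ × ℤ | 0 ≤ p.1 ∧ p.1 < (b : ℤ) ∧ 0 ≤ p.2 ∧ p.2 < (a : ℤ)}



/-! ## General tools -/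

inductive Dir | N | E | S | W
deriving DecidableEq

instance : Fintype Dir := ⟨{.N, .E, .S, .W}, fun d => by cases d <;> simp⟩

def nb (p : ℤ × ℤ) : Dir → ℤ × ℤ
  | .N => (p.1, p.2 + 1)
  | .E => (p.1 + 1, p.2)
  | .S => (p.1, p.2 - 1)
  | .W => (p.1 - 1, p.2)

def opp : Dir → Dir
  | .N => .S
  | .E => .W
  | .S => .N
  | .W => .E

def side (t : Tile) : Dir → Glue
  | .N => t.north
  | .E => t.east
  | .S => t.south
  | .W => t.west

def face (o : Option Tile) (d : Dir) : Glue :=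
  match o with
  | some t => side t d
  | none => 0

def sum4 (f : Dir → ℕ) : ℕ := f .N + f .E + f .S + f .W

lemma nb_opp (p : ℤ × ℤ) (d : Dir) : nb (nb p d) (opp d) = p := by
  cases d <;> simp [nb, opp]

lemma opp_opp (d : Dir) : opp (opp d) = d := by cases d <;> rfl

lemma sum4_le {f g : Dir → ℕ} (h : ∀ d, f d ≤ g d) : sum4 f ≤ sum4 g := by
  have h1 := h .N
  have h2 := h .E
  have h3 := h .S
  have h4 := h .W
  unfold sum4
  omega

lemma bond_zero {G : Glue → ℕ} (h0 : G 0 = 0) (x : Glue) : bond G x 0 = 0 := by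
  unfold bond
  split_ifs with h
  · rw [h, h0]
  · rfl

lemma zero_bond {G : Glue → ℕ} (h0 : G 0 = 0) (x : Glue) : bond G 0 x = 0 := by
  unfold bond
  split_ifs with h
  · exact h0
  · rfl

def att (G : Glue → ℕ) (C : Config) (t : Tile) (p : ℤ × ℤ) : ℕ :=
  sum4 fun d => bond G (side t d) (face (C (nb p d)) (opp d))

lemma edgeBond_nb (G : Glue → ℕ) (t u : Tile) (p : ℤ × ℤ) (d : Dir) :
    edgeBond G t u p (nb p d) = bond G (side t d) (side u (opp d)) := by
  obtain ⟨a, b⟩ := p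
  cases d <;> simp [edgeBond, nb, side, opp]
  all_goals
    intro h
    omega

lemma attachStrength_eq {G : Glue → ℕ} (h0 : G 0 = 0) (C : Config) (t : Tile) (p : ℤ × ℤ) :
    attachStrength G C t p = att G C t p := by
  have key : ∀ d, (match C (nb p d) with
    | some u => edgeBond G t u p (nb p d)
    | none => 0) = bond G (side t d) (face (C (nb p d)) (opp d)) := by
    intro d
    cases h : C (nb p d) with
    | none => simp [face, bond_zero h0]
    | some u => simp [face, edgeBond_nb]
  have := key .N
  have := key .E
  have := key .S
  have := key .W
  simp only [attachStrength, neighbors, att, sum4, List.map_cons, List.map_nil, List.sum_cons,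
    List.sum_nil, ← key]
  simp only [nb]
  omega

def bd (G : Glue → ℕ) (C : Config) (a : ℤ × ℤ) (d : Dir) : ℕ :=
  bond G (face (C a) d) (face (C (nb a d)) (opp d))

lemma bondAt_nb {G : Glue → ℕ} (h0 : G 0 = 0) (C : Config) (p : ℤ × ℤ) (d : Dir) :
    bondAt G C p (nb p d) = bd G C p d := by
  unfold bondAt bd
  cases h : C p with
  | none => simp [face, zero_bond h0]
  | some t =>
    cases h' : C (nb p d) with
    | none => simp [face, bond_zero h0]
    | some u => simp [face, edgeBond_nb]

def cut (G : Glue → ℕ) (C : Config) (Q : Finset (ℤ × ℤ)) : ℕ :=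
  ∑ a ∈ Q, sum4 fun d => if nb a d ∈ Q then 0 else bd G C a d

lemma cutStrength_eq {G : Glue → ℕ} (h0 : G 0 = 0) (C : Config) (Q : Finset (ℤ × ℤ)) :
    cutStrength G C Q = cut G C Q := by
  unfold cutStrength cut
  refine Finset.sum_congr rfl fun a _ => ?_
  have key : ∀ l : List (ℤ × ℤ), ((l.filter (fun q => q ∉ Q)).map (fun q => bondAt G C a q)).sum
      = (l.map fun q => if q ∈ Q then 0 else bondAt G C a q).sum := by
    intro l
    induction l with
    | nil => rfl
    | cons x l ih =>
      by_cases hx : x ∈ Q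
      · simpa [List.filter_cons, hx] using ih
      · simpa [List.filter_cons, hx] using ih
  rw [outStrength, key]
  simp only [sum4, ← bondAt_nb h0]
  simp only [neighbors, nb, List.map_cons, List.map_nil, List.sum_cons, List.sum_nil]
  ring_nf

def Stable (G : Glue → ℕ) (τ : ℕ) (C : Config) : Prop :=
  ∀ Q : Finset (ℤ × ℤ), Q.Nonempty → ((0, 0) : ℤ × ℤ) ∉ Q → (∀ q ∈ Q, C q ≠ none) →
    τ ≤ cut G C Q

lemma Stable.mono {G : Glue → ℕ} {τ τ' : ℕ} {C : Config} (h : Stable G τ C) (hle : τ' ≤ τ) :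
    Stable G τ' C := fun Q a b c => hle.trans (h Q a b c)

/-- `Extn S C`: the configuration `C` extends `S`. -/
def Extn (S C : Config) : Prop := ∀ p, S p ≠ none → C p = S p

lemma Extn.ne {S C : Config} (h : Extn S C) {p : ℤ × ℤ} (hp : S p ≠ none) : C p ≠ none := by
  rw [h p hp]
  exact hp

lemma cut_mono {G : Glue → ℕ} (h0 : G 0 = 0) {S C : Config} (h : Extn S C)
    (Q : Finset (ℤ × ℤ)) : cut G S (Q.filter fun q => S q ≠ none) ≤ cut G C Q := by
  unfold cut
  refine le_trans (Finset.sum_le_sum (fun a ha => ?_))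
    (Finset.sum_le_sum_of_subset (Finset.filter_subset (fun q => S q ≠ none) Q))
  rw [Finset.mem_filter] at ha
  refine sum4_le fun d => ?_
  by_cases hS : S (nb a d) = none
  · have : bd G S a d = 0 := by simp [bd, hS, face, bond_zero h0]
    simp [this]
  · by_cases hQ : nb a d ∈ Q
    · have : nb a d ∈ Q.filter fun q => S q ≠ none := Finset.mem_filter.2 ⟨hQ, hS⟩
      rw [if_pos this, if_pos hQ]
    · have : nb a d ∉ Q.filter fun q => S q ≠ none := fun h => hQ (Finset.mem_filter.1 h).1
      rw [if_neg this, if_neg hQ, bd, bd, h _ ha.2, h _ hS]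

lemma stable_extend {G : Glue → ℕ} (h0 : G 0 = 0) {τ : ℕ} {S C : Config} (hS : Stable G τ S)
    (h : Extn S C)
    (hnew : ∀ Q : Finset (ℤ × ℤ), Q.Nonempty → (∀ q ∈ Q, C q ≠ none ∧ S q = none) →
      τ ≤ cut G C Q) : Stable G τ C := by
  intro Q hne h00 hQ
  by_cases hf : (Q.filter fun q => S q ≠ none).Nonempty
  · refine le_trans (hS _ hf (fun hh => h00 (Finset.mem_filter.1 hh).1)
      (fun q hq => (Finset.mem_filter.1 hq).2)) (cut_mono h0 h Q)
  · refine hnew Q hne fun q hq => ⟨hQ q hq, ?_⟩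
    by_contra hc
    exact hf ⟨q, Finset.mem_filter.2 ⟨hq, hc⟩⟩

lemma nb_ne (p : ℤ × ℤ) (d : Dir) : nb p d ≠ p := by
  obtain ⟨a, b⟩ := p
  cases d <;> simp [nb]

lemma stable_attach {G : Glue → ℕ} (h0 : G 0 = 0) {τ : ℕ} {C : Config} (hC : Stable G τ C)
    {t : Tile} {p : ℤ × ℤ} (hp : C p = none) (ha : τ ≤ att G C t p) :
    Stable G τ (Function.update C p (some t)) := by
  refine stable_extend h0 hC ?_ ?_
  · intro q hq
    rw [Function.update_of_ne]
    rintro rfl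
    exact hq hp
  · intro Q hne hQ
    have : Q = {p} := by
      refine Finset.eq_singleton_iff_nonempty_unique_mem.2 ⟨hne, fun q hq => ?_⟩
      by_contra hqp
      have := hQ q hq
      rw [Function.update_of_ne hqp] at this
      exact this.1 this.2
    subst this
    refine ha.trans (le_of_eq ?_)
    simp only [cut, Finset.sum_singleton, att, Finset.mem_singleton, nb_ne, if_false, bd,
      Function.update_self, face, ne_eq, not_false_eq_true, Function.update_of_ne]

/-- A phase that always finishes, with unique outcome `R`. -/
def PhaseTo (step : Config → Config → Prop) (C R : Config) : Prop :=
  PhaseTerminates step C ∧ Relation.ReflTransGen step C R ∧ Terminal step R ∧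
    ∀ D, Relation.ReflTransGen step C D → Terminal step D → D = R

lemma phase_of_inv {step : Config → Config → Prop} (I : Config → Prop) (μ : Config → ℕ)
    {C R : Config} (hC : I C)
    (hstep : ∀ D E, I D → step D E → I E ∧ μ E < μ D)
    (hprog : ∀ D, I D → D ≠ R → ∃ E, step D E) :
    PhaseTo step C R ∧ I R := by
  have hreach : ∀ D, Relation.ReflTransGen step C D → I D := by
    intro D h
    induction h with
    | refl => exact hC
    | tail _ h ih => exact (hstep _ _ ih h).1
  have huniq : ∀ D, I D → Terminal step D → D = R := by
    intro D hD ht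
    by_contra hne
    obtain ⟨E, hE⟩ := hprog D hD hne
    exact ht E hE
  have hex : ∀ n, ∀ D, μ D ≤ n → I D → ∃ E, Relation.ReflTransGen step D E ∧ Terminal step E := by
    intro n
    induction n with
    | zero =>
      intro D hD hI
      refine ⟨D, .refl, fun E hE => ?_⟩
      have := (hstep _ _ hI hE).2
      omega
    | succ n ih =>
      intro D hD hI
      by_cases ht : Terminal step D
      · exact ⟨D, .refl, ht⟩
      · simp only [Terminal, not_forall, not_not] at ht
        obtain ⟨E, hE⟩ := ht
        have h1 := hstep _ _ hI hE
        obtain ⟨F, hF, hF'⟩ := ih E (by omega) h1.1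
        exact ⟨F, .head hE hF, hF'⟩
  obtain ⟨E, hE, hEt⟩ := hex _ C le_rfl hC
  have hER := huniq E (hreach E hE) hEt
  subst hER
  refine ⟨⟨?_, hE, hEt, fun D hD ht => huniq D (hreach D hD) ht⟩, hreach E hE⟩
  rintro ⟨f, hf0, hf⟩
  have hIf : ∀ n, I (f n) := by
    intro n
    induction n with
    | zero => rw [hf0]; exact hC
    | succ n ih => exact (hstep _ _ ih (hf n)).1
  have hdec : ∀ n, μ (f n) + n ≤ μ (f 0) := by
    intro n
    induction n with
    | zero => simp
    | succ n ih =>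
      have := (hstep _ _ (hIf n) (hf n)).2
      omega
  have := hdec (μ (f 0) + 1)
  omega

lemma phase_step {step : Config → Config → Prop} {C R : Config}
    (hex : ∃ D, step C D) (h : ∀ D, step C D → PhaseTo step D R) : PhaseTo step C R := by
  obtain ⟨D, hD⟩ := hex
  refine ⟨?_, .head hD (h D hD).2.1, (h D hD).2.2.1, ?_⟩
  · rintro ⟨f, hf0, hf⟩
    have h1 : step C (f 1) := hf0 ▸ hf 0
    exact (h _ h1).1 ⟨fun n => f (n + 1), rfl, fun n => hf (n + 1)⟩
  · intro E hE ht
    rcases Relation.ReflTransGen.cases_head hE with h1 | ⟨F, hF, hFE⟩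
    · subst h1
      exact absurd hD (ht D)
    · exact (h F hF).2.2.2 E hFE ht

def Good (step : ℕ → Config → Config → Prop) (τs : List ℕ) (C R : Config) : Prop :=
  AllFinish step τs C ∧ MultiReach step τs C R ∧ ∀ D, MultiReach step τs C D → D = R

lemma good_nil (step : ℕ → Config → Config → Prop) (C : Config) : Good step [] C C := by
  refine ⟨.nil, .nil, ?_⟩
  intro D h
  cases h
  rfl

lemma good_cons {step : ℕ → Config → Config → Prop} {τ : ℕ} {τs : List ℕ} {C D R : Config}
    (h1 : PhaseTo (step τ) C D) (h2 : Good step τs D R) : Good step (τ :: τs) C R := by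
  refine ⟨.cons h1.1 ?_, .cons h1.2.1 h1.2.2.1 h2.2.1, ?_⟩
  · intro E hE ht
    rw [h1.2.2.2 E hE ht]
    exact h2.1
  · intro E hE
    cases hE with
    | cons a b c =>
      rw [h1.2.2.2 _ a b] at c
      exact h2.2.2 _ c

open Classical in
/-- What a position may be offered by its neighbours at side `d` while it is still empty. -/
noncomputable def quad (S R : Config) (rq : Tile → Dir → Bool) (p : ℤ × ℤ) (d : Dir) : Glue :=
  match R (nb p d) with
  | none => 0
  | some u => if S (nb p d) = none ∧ rq u (opp d) = true then 0 else side u (opp d)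

def Closed (S : Config) (rq : Tile → Dir → Bool) (C : Config) : Prop :=
  ∀ p t, S p = none → C p = some t → ∀ d, rq t d = true → C (nb p d) ≠ none

lemma phaseB {β : Type*} [LinearOrder β] {T : Finset Tile} {G : Glue → ℕ} {τ : ℕ} {S R : Config}
    (h0 : G 0 = 0) (rq : Tile → Dir → Bool) (rank : ℤ × ℤ → β) (Bd : Finset (ℤ × ℤ))
    (hSR : Extn S R) (hBd : ∀ p, R p ≠ none → p ∈ Bd) (hst : Stable G τ S)
    (hT : ∀ p u, S p = none → R p = some u → u ∈ T)
    (hdet : ∀ p t, S p = none → t ∈ T →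
      τ ≤ sum4 (fun d => bond G (side t d) (quad S R rq p d)) → R p = some t)
    (hreq : ∀ C p t, Extn S C → Extn C R → Closed S rq C → C p = none → R p = some t →
      τ ≤ att G C t p → ∀ d, rq t d = true → C (nb p d) ≠ none)
    (hprog : ∀ p u, S p = none → R p = some u →
      τ ≤ sum4 (fun d => if S (nb p d) ≠ none ∨ rq u d = true
        then bond G (side u d) (face (R (nb p d)) (opp d)) else 0))
    (hrank : ∀ p u, S p = none → R p = some u → ∀ d, rq u d = true →
      R (nb p d) ≠ none ∧ (S (nb p d) ≠ none ∨ rank (nb p d) < rank p)) :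
    PhaseTo (Step T G τ) S R ∧ Stable G τ R := by
  classical
  have key := phase_of_inv (step := Step T G τ) (C := S) (R := R)
    (fun C => Extn S C ∧ Extn C R ∧ Closed S rq C ∧ Stable G τ C)
    (fun C => (Bd.filter fun p => C p = none).card) ⟨fun _ _ => rfl, hSR, ?_, hst⟩ ?_ ?_
  · exact ⟨key.1, key.2.2.2.2⟩
  · intro p t h1 h2
    rw [h1] at h2
    exact absurd h2 (by simp)
  · rintro D E ⟨hSD, hDR, hcl, hsD⟩ hstep
    cases hstep with
    | detach Q hne h00 hQ hcut =>
      rw [cutStrength_eq h0] at hcut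
      exact absurd (hsD Q hne h00 (fun q hq => hQ hq)) (by omega)
    | attach t p ht hp ha =>
      rw [attachStrength_eq h0] at ha
      have hSp : S p = none := by
        by_contra hc
        exact hSD.ne hc hp
      have hle : att G D t p ≤ sum4 (fun d => bond G (side t d) (quad S R rq p d)) := by
        refine sum4_le fun d => ?_
        cases hn : D (nb p d) with
        | none => simp [face, bond_zero h0]
        | some u =>
          have hR : R (nb p d) = some u := by
            rw [hDR _ (by simp [hn]), hn]
          have : ¬ (S (nb p d) = none ∧ rq u (opp d) = true) := by
            rintro ⟨h1, h2⟩
            have := hcl _ _ h1 hn _ h2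
            rw [nb_opp] at this
            exact this hp
          simp only [quad, hR, if_neg this, face]
          exact le_rfl
      have hRp : R p = some t := hdet p t hSp ht (ha.trans hle)
      refine ⟨⟨?_, ?_, ?_, stable_attach h0 hsD hp ha⟩, ?_⟩
      · intro q hq
        have : q ≠ p := by
          rintro rfl
          exact hq hSp
        rw [Function.update_of_ne this]
        exact hSD q hq
      · intro q hq
        by_cases hqp : q = p
        · subst hqp
          simp [hRp]
        · rw [Function.update_of_ne hqp] at hq ⊢
          exact hDR q hq
      · intro q u hq hu d hd
        have hm : ∀ r, D r ≠ none → Function.update D p (some t) r ≠ none := by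
          intro r hr
          by_cases hrp : r = p
          · subst hrp
            simp
          · rwa [Function.update_of_ne hrp]
        by_cases hqp : q = p
        · subst hqp
          simp only [Function.update_self, Option.some.injEq] at hu
          subst hu
          exact hm _ (hreq D q t hSD hDR hcl hp hRp ha d hd)
        · rw [Function.update_of_ne hqp] at hu
          exact hm _ (hcl q u hq hu d hd)
      · refine Finset.card_lt_card (Finset.ssubset_iff_of_subset ?_ |>.2 ⟨p, ?_, ?_⟩)
        · intro q hq
          rw [Finset.mem_filter] at hq ⊢
          refine ⟨hq.1, ?_⟩
          by_cases hqp : q = p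
          · subst hqp
            exact hp
          · rw [Function.update_of_ne hqp] at hq
            exact hq.2
        · exact Finset.mem_filter.2 ⟨hBd p (by simp [hRp]), hp⟩
        · simp
  · rintro D ⟨hSD, hDR, hcl, hsD⟩ hne
    have hex : (Bd.filter fun p => D p = none ∧ R p ≠ none).Nonempty := by
      by_contra hc
      apply hne
      funext p
      by_cases hD : D p = none
      · by_contra hR
        refine hc ⟨p, Finset.mem_filter.2 ⟨hBd p ?_, hD, ?_⟩⟩ <;>
        · intro h
          exact hR (hD.trans h.symm)
      · exact (hDR p hD).symm
    obtain ⟨p, hp, hmin⟩ := Finset.exists_min_image _ rank hex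
    rw [Finset.mem_filter] at hp
    obtain ⟨-, hDp, hRp⟩ := hp
    obtain ⟨u, hu⟩ := Option.ne_none_iff_exists'.1 hRp
    have hSp : S p = none := by
      by_contra hc
      exact hSD.ne hc hDp
    refine ⟨_, Step.attach D u p (hT p u hSp hu) hDp ?_⟩
    rw [attachStrength_eq h0]
    refine (hprog p u hSp hu).trans (sum4_le fun d => ?_)
    split_ifs with hc
    · have hn : D (nb p d) ≠ none := by
        rcases hc with hc | hc
        · exact hSD.ne hc
        · obtain ⟨h1, h2⟩ := hrank p u hSp hu d hc
          rcases h2 with h2 | h2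
          · exact hSD.ne h2
          · intro h3
            exact absurd (hmin (nb p d) (Finset.mem_filter.2 ⟨hBd _ h1, h3, h1⟩)) (not_le.2 h2)
      rw [hDR _ hn]
    · exact Nat.zero_le _

/-- The simple criterion for `hreq` of `phaseB`. -/
lemma req_of_lt {G : Glue → ℕ} {τ : ℕ} (h0 : G 0 = 0) {S R C : Config} {rq : Tile → Dir → Bool}
    (hCR : Extn C R) (hcl : Closed S rq C) {p : ℤ × ℤ} {t : Tile} (hp : C p = none)
    (ha : τ ≤ att G C t p) (d : Dir)
    (hlt : sum4 (fun e => if e = d then 0 else bond G (side t e) (quad S R rq p e)) < τ) :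
    C (nb p d) ≠ none := by
  intro hd
  refine absurd (ha.trans ?_) (not_le.2 hlt)
  refine sum4_le fun e => ?_
  cases hn : C (nb p e) with
  | none => simp [face, bond_zero h0]
  | some u =>
    have hed : e ≠ d := by
      rintro rfl
      rw [hd] at hn
      simp at hn
    have hR : R (nb p e) = some u := by
      rw [hCR _ (by simp [hn]), hn]
    have : ¬ (S (nb p e) = none ∧ rq u (opp e) = true) := by
      rintro ⟨h1, h2⟩
      have := hcl _ _ h1 hn _ h2
      rw [nb_opp] at this
      exact this hp
    simp only [quad, hR, if_neg this, face, if_neg hed]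
    exact le_rfl


/-! ## The tiles -/

namespace Sq

abbrev seed : Tile := ⟨1, 20, 0, 21⟩
abbrev s1 : Tile := ⟨0, 28, 0, 20⟩
abbrev s2 : Tile := ⟨0, 21, 0, 22⟩
abbrev s3 : Tile := ⟨0, 22, 0, 0⟩
abbrev x1 : Tile := ⟨6, 7, 1, 2⟩
abbrev x2 : Tile := ⟨8, 2, 0, 3⟩
abbrev x3 : Tile := ⟨4, 3, 0, 0⟩
abbrev x4 : Tile := ⟨5, 0, 4, 0⟩
abbrev x5 : Tile := ⟨44, 9, 5, 0⟩
abbrev tB : Tile := ⟨44, 10, 0, 9⟩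
abbrev tD : Tile := ⟨44, 23, 11, 10⟩
abbrev ty : Tile := ⟨11, 13, 6, 12⟩
abbrev tg : Tile := ⟨14, 12, 8, 0⟩
abbrev tz : Tile := ⟨0, 15, 14, 0⟩
abbrev z2 : Tile := ⟨1, 16, 0, 15⟩
abbrev te : Tile := ⟨0, 27, 17, 16⟩
abbrev f0 : Tile := ⟨17, 27, 18, 0⟩
abbrev d0 : Tile := ⟨18, 25, 0, 0⟩
abbrev d1 : Tile := ⟨19, 26, 0, 7⟩
abbrev f1 : Tile := ⟨0, 27, 19, 13⟩

def wTiles : List Tile :=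
  [seed, s1, s2, s3, x1, x2, x3, x4, x5, tB, tD, ty, tg, tz, z2, te, f0, d0, d1, f1]

def fTiles : List Tile :=
  [⟨44, 24, 0, 23⟩, ⟨44, 29, 38, 24⟩, ⟨38, 25, 38, 25⟩, ⟨38, 26, 38, 26⟩, ⟨38, 27, 38, 27⟩,
   ⟨38, 30, 0, 28⟩, ⟨43, 28, 0, 30⟩, ⟨42, 25, 42, 25⟩, ⟨42, 26, 43, 25⟩, ⟨42, 26, 42, 26⟩,
   ⟨43, 25, 43, 26⟩, ⟨42, 27, 42, 27⟩, ⟨43, 27, 43, 27⟩, ⟨44, 24, 42, 29⟩, ⟨44, 31, 43, 29⟩,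
   ⟨45, 33, 39, 31⟩, ⟨39, 32, 39, 25⟩, ⟨39, 32, 39, 27⟩, ⟨39, 32, 0, 28⟩, ⟨40, 32, 40, 32⟩,
   ⟨41, 33, 40, 32⟩, ⟨47, 34, 41, 33⟩, ⟨47, 34, 47, 34⟩, ⟨44, 36, 44, 36⟩, ⟨45, 37, 44, 36⟩,
   ⟨46, 35, 45, 37⟩, ⟨46, 35, 46, 35⟩, ⟨47, 35, 47, 35⟩]

def tiles : List Tile := wTiles ++ fTiles

def T : Finset Tile := tiles.toFinset

def gl : List ℕ :=
  [0, 10, 10, 10, 10, 10, 5, 6, 5, 7, 7, 2, 10, 5, 10, 10, 10, 10, 10, 5, 10, 10, 10,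
   2, 2, 1, 1, 1, 1, 1, 2, 2, 1, 2, 1, 1, 1, 1, 1, 1, 1, 1, 1, 1, 1, 2, 1, 1]

def G (g : Glue) : ℕ := gl.getD g 0

lemma G0 : G 0 = 0 := rfl

/-! ## The tower -/

def tabL : ℕ → List (Option Tile)
  | 1 => [some x3, some x4, some x5, some x2, none, none, some x1, none, none, none, none, none]
  | 2 => [some x3, some x4, some x5, some x2, some tg, some tB, some x1, some ty, some tD,
      none, none, none]
  | 8 => [some x3, some x4, some x5, some x2, some tg, some tB, some x1, some ty, some tD,
      some d1, some f1, none]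
  | 3 => [some x3, some x4, some x5, some x2, some tg, none, some x1, some ty, none,
      none, none, none]
  | 10 => [some x3, some x4, some x5, some x2, some tg, none, some x1, some ty, none,
      some d1, some f1, none]
  | 4 => [some x3, some x4, some x5, some x2, some tg, some tB, some x1, some ty, none,
      none, none, none]
  | 11 => [some x3, some x4, some x5, some x2, some tg, some tB, some x1, some ty, none,
      some d1, some f1, none]
  | 5 => [some x3, some x4, some x5, some x2, some tg, some tz, some x1, some ty, some z2,
      some d0, some f0, some te]
  | 9 => [some x3, some x4, some x5, some x2, some tg, some tz, some x1, some ty, some z2,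
      some d1, some f1, some te]
  | 6 => [none, none, some s3, none, none, some s2, none, none, some seed, none, none, some s1]
  | 7 => [none, none, none, none, none, none, none, none, some seed, none, none, none]
  | _ => []

def cell (s : ℕ) (x r : ℤ) : Option Tile :=
  if -2 ≤ x ∧ x ≤ 1 ∧ 0 ≤ r ∧ r ≤ 2 then (tabL s).getD (3 * (x + 2) + r).toNat none else none

def cellL (a b c : ℕ) (q : ℤ × ℤ) : Option Tile :=
  if q.2 = -1 then cell a q.1 2 else if q.2 = 3 then cell c q.1 0 else cell b q.1 q.2

def Tw (σ : ℤ → ℕ) : Config := fun p => cell (σ ((p.2 + 2) / 3)) p.1 ((p.2 + 2) % 3)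

def clamp (x : ℤ) : ℤ := max (-4) (min 3 x)

lemma cell_clamp (s : ℕ) (x dx r : ℤ) (h : -1 ≤ dx ∧ dx ≤ 1) :
    cell s (x + dx) r = cell s (clamp x + dx) r := by
  unfold clamp
  by_cases hx : -4 ≤ x ∧ x ≤ 3
  · rw [min_eq_right hx.2, max_eq_right hx.1]
  · unfold cell
    rw [if_neg (by omega), if_neg (by omega)]

lemma Tw_local (σ : ℤ → ℕ) (x y dx dy : ℤ) (hx : -1 ≤ dx ∧ dx ≤ 1) (hy : -1 ≤ dy ∧ dy ≤ 1) :
    Tw σ (x + dx, y + dy) = cellL (σ ((y + 2) / 3 - 1)) (σ ((y + 2) / 3)) (σ ((y + 2) / 3 + 1))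
      (clamp x + dx, (y + 2) % 3 + dy) := by
  unfold Tw cellL
  simp only
  rw [cell_clamp _ _ _ _ hx]
  by_cases h1 : (y + 2) % 3 + dy = -1
  · rw [if_pos h1]
    congr 2 <;> omega
  · rw [if_neg h1]
    by_cases h2 : (y + 2) % 3 + dy = 3
    · rw [if_pos h2]
      congr 2 <;> omega
    · rw [if_neg h2]
      congr 2 <;> omega

def xs : List ℤ := [-4, -3, -2, -1, 0, 1, 2, 3]
def rs : List ℤ := [0, 1, 2]

lemma clamp_mem (x : ℤ) : clamp x ∈ xs := by
  have h1 : -4 ≤ clamp x := by unfold clamp; omega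
  have h2 : clamp x ≤ 3 := by unfold clamp; omega
  generalize clamp x = z at h1 h2
  interval_cases z <;> decide

lemma mod_mem (y : ℤ) : (y + 2) % 3 ∈ rs := by
  have h1 : 0 ≤ (y + 2) % 3 := by omega
  have h2 : (y + 2) % 3 ≤ 2 := by omega
  generalize (y + 2) % 3 = z at h1 h2
  interval_cases z <;> decide

def rqL : List (Tile × List Dir) :=
  [(tD, [.W]), (ty, [.N]), (tg, [.E, .N]), (f1, [.S, .W]), (z2, [.W]), (te, [.W]), (f0, [.N]),
   (d0, [.N]), (x1, [.S]), (x2, [.E]), (x3, [.E]), (x4, [.S]), (x5, [.S]), (s1, [.W]),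
   (s2, [.E]), (s3, [.E])]

def rqW (t : Tile) (d : Dir) : Bool := rqL.any fun e => decide (e.1 = t) && decide (d ∈ e.2)

def rkL : List (Tile × ℕ) :=
  [(tD, 1), (ty, 2), (tg, 3), (f1, 3), (z2, 1), (te, 2), (f0, 3), (d0, 4), (x1, 2), (x2, 3),
   (x3, 4), (x4, 5), (x5, 6), (s1, 1), (s2, 1), (s3, 2)]

def rkW (o : Option Tile) : ℕ :=
  match o with
  | none => 0
  | some t => ((rkL.find? fun e => decide (e.1 = t)).map Prod.snd).getD 0

def quadL (s r : Option Tile) (rq : Tile → Dir → Bool) (d : Dir) : Glue :=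
  match r with
  | none => 0
  | some u => if s.isNone && rq u (opp d) then 0 else side u (opp d)

lemma quad_eq (S R : Config) (rq : Tile → Dir → Bool) (p : ℤ × ℤ) (d : Dir) :
    quad S R rq p d = quadL (S (nb p d)) (R (nb p d)) rq d := by
  unfold quad quadL
  cases R (nb p d) with
  | none => rfl
  | some u => simp

def simpleReq (τ : ℕ) (u : Tile) (s r : Dir → Option Tile) (d : Dir) : Prop :=
  (s d).isSome ∨ sum4 (fun e => if e = d then 0 else bond G (side u e) (quadL (s e) (r e) rqW e)) < τ

instance (τ : ℕ) (u : Tile) (s r : Dir → Option Tile) (d : Dir) :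
    Decidable (simpleReq τ u s r d) := by unfold simpleReq; infer_instance

def specialReq (τ : ℕ) (u : Tile) (s r : Dir → Option Tile) (sNE rNE : Option Tile) (d : Dir) :
    Prop :=
  d = .N ∧ simpleReq τ u s r .E ∧ s .E = none ∧ r .E = some ty ∧ sNE = none ∧ rNE = some tD

instance (τ : ℕ) (u : Tile) (s r : Dir → Option Tile) (sNE rNE : Option Tile) (d : Dir) :
    Decidable (specialReq τ u s r sNE rNE d) := by unfold specialReq; infer_instance

def newOK (τ : ℕ) (u : Tile) (s r : Dir → Option Tile) (sNE rNE : Option Tile) : Prop :=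
  u ∈ tiles ∧
  (∀ d, rqW u d = true → simpleReq τ u s r d ∨ specialReq τ u s r sNE rNE d) ∧
  (τ ≤ sum4 (fun d => if (s d).isSome ∨ rqW u d = true
        then bond G (side u d) (face (r d) (opp d)) else 0)) ∧
  (∀ d, rqW u d = true → (r d).isSome ∧ ((s d).isSome ∨ rkW (r d) < rkW (some u)))

instance (τ : ℕ) (u : Tile) (s r : Dir → Option Tile) (sNE rNE : Option Tile) :
    Decidable (newOK τ u s r sNE rNE) := by unfold newOK; infer_instance

def detOK (τ : ℕ) (r0 : Option Tile) (q : Dir → Glue) : Prop :=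
  ∀ t ∈ tiles, τ ≤ sum4 (fun d => bond G (side t d) (q d)) → r0 = some t

instance (τ : ℕ) (r0 : Option Tile) (q : Dir → Glue) :
    Decidable (detOK τ r0 q) := by unfold detOK; infer_instance

def LocOK (τ : ℕ) (s0 r0 : Option Tile) (s r : Dir → Option Tile) (sNE rNE : Option Tile) : Prop :=
  match s0 with
  | some t => r0 = some t
  | none => detOK τ r0 (fun d => quadL (s d) (r d) rqW d) ∧
     match r0 with
     | none => True
     | some u => newOK τ u s r sNE rNE

instance (τ : ℕ) (s0 r0 : Option Tile) (s r : Dir → Option Tile) (sNE rNE : Option Tile) :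
    Decidable (LocOK τ s0 r0 s r sNE rNE) := by
  unfold LocOK
  cases s0 <;> cases r0 <;> infer_instance

def ChkOK (τ : ℕ) (a b c : ℕ × ℕ) (x r : ℤ) : Prop :=
  LocOK τ (cellL a.1 b.1 c.1 (x, r)) (cellL a.2 b.2 c.2 (x, r))
    (fun d => cellL a.1 b.1 c.1 (nb (x, r) d)) (fun d => cellL a.2 b.2 c.2 (nb (x, r) d))
    (cellL a.1 b.1 c.1 (x + 1, r + 1)) (cellL a.2 b.2 c.2 (x + 1, r + 1))

instance (τ : ℕ) (a b c : ℕ × ℕ) (x r : ℤ) : Decidable (ChkOK τ a b c x r) := by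
  unfold ChkOK; infer_instance

def Chk (τ : ℕ) (adj : List ((ℕ × ℕ) × (ℕ × ℕ))) : Prop :=
  ∀ e ∈ adj, ∀ f ∈ adj, e.2 = f.1 → ∀ x ∈ xs, ∀ r ∈ rs, ChkOK τ e.1 e.2 f.2 x r

instance (τ : ℕ) (adj : List ((ℕ × ℕ) × (ℕ × ℕ))) : Decidable (Chk τ adj) := by
  unfold Chk; infer_instance

def adjL (A N : ℕ × ℕ) : List ((ℕ × ℕ) × (ℕ × ℕ)) :=
  [((0, 0), (0, 0)), ((0, 0), (6, 6)), ((6, 6), (5, 5)), ((6, 6), (9, 9)), ((6, 6), A),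
   ((5, 5), (5, 5)), ((5, 5), (9, 9)), ((9, 9), (5, 5)), ((9, 9), (9, 9)),
   ((5, 5), A), ((9, 9), A), (A, N), (N, (0, 0))]

lemma chk0 : Chk 10 [((0, 0), (0, 0)), ((0, 0), (7, 6)), ((7, 6), (0, 1)), ((0, 1), (0, 0))] := by
  decide +kernel
lemma chkV0 : Chk 7 (adjL (1, 2) (0, 0)) := by decide +kernel
lemma chkV1 : Chk 6 (adjL (1, 8) (0, 0)) := by decide +kernel
lemma chkW0 : Chk 10 (adjL (3, 5) (0, 1)) := by decide +kernel
lemma chkW1 : Chk 10 (adjL (10, 9) (0, 1)) := by decide +kernel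



lemma isSome_iff {o : Option Tile} : o.isSome = true ↔ o ≠ none := by
  cases o <;> simp

lemma mem_T {t : Tile} : t ∈ T ↔ t ∈ tiles := List.mem_toFinset

/-- Everything about the neighbourhood of `p` is visible in the local picture. -/
lemma Tw_loc (σ : ℤ → ℕ) (p : ℤ × ℤ) :
    (Tw σ p = cellL (σ ((p.2 + 2) / 3 - 1)) (σ ((p.2 + 2) / 3)) (σ ((p.2 + 2) / 3 + 1))
      (clamp p.1, (p.2 + 2) % 3)) ∧
    (∀ d, Tw σ (nb p d) = cellL (σ ((p.2 + 2) / 3 - 1)) (σ ((p.2 + 2) / 3))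
      (σ ((p.2 + 2) / 3 + 1)) (nb (clamp p.1, (p.2 + 2) % 3) d)) ∧
    (Tw σ (nb (nb p .E) .N) = cellL (σ ((p.2 + 2) / 3 - 1)) (σ ((p.2 + 2) / 3))
      (σ ((p.2 + 2) / 3 + 1)) (clamp p.1 + 1, (p.2 + 2) % 3 + 1)) := by
  obtain ⟨x, y⟩ := p
  refine ⟨?_, ?_, ?_⟩
  · simpa using Tw_local σ x y 0 0 (by omega) (by omega)
  · intro d
    cases d
    · simpa [nb] using Tw_local σ x y 0 1 (by omega) (by omega)
    · simpa [nb] using Tw_local σ x y 1 0 (by omega) (by omega)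
    · simpa [nb, sub_eq_add_neg] using Tw_local σ x y 0 (-1) (by omega) (by omega)
    · simpa [nb, sub_eq_add_neg] using Tw_local σ x y (-1) 0 (by omega) (by omega)
  · simpa [nb] using Tw_local σ x y 1 1 (by omega) (by omega)

lemma cell_zero (x r : ℤ) : cell 0 x r = none := by
  simp [cell, tabL]

lemma cell_ne {s : ℕ} {x r : ℤ} (h : cell s x r ≠ none) : -2 ≤ x ∧ x ≤ 1 := by
  unfold cell at h
  split_ifs at h with hc
  · exact ⟨hc.1, hc.2.1⟩
  · exact absurd rfl h

lemma towerPhase {τ : ℕ} {adj : List ((ℕ × ℕ) × (ℕ × ℕ))} (hchk : Chk τ adj)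
    (σ ρ : ℤ → ℕ) (hadj : ∀ J, ((σ J, ρ J), (σ (J + 1), ρ (J + 1))) ∈ adj)
    (M : ℤ) (hM : ∀ J, J < -M ∨ M < J → ρ J = 0) (hst : Stable G τ (Tw σ)) :
    PhaseTo (Step T G τ) (Tw σ) (Tw ρ) ∧ Stable G τ (Tw ρ) := by
  have hloc : ∀ p, LocOK τ (Tw σ p) (Tw ρ p) (fun d => Tw σ (nb p d)) (fun d => Tw ρ (nb p d))
      (Tw σ (nb (nb p .E) .N)) (Tw ρ (nb (nb p .E) .N)) := by
    intro p
    have h1 := hadj ((p.2 + 2) / 3 - 1)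
    rw [sub_add_cancel] at h1
    have := hchk _ h1 _ (hadj ((p.2 + 2) / 3)) rfl _ (clamp_mem p.1) _ (mod_mem p.2)
    unfold ChkOK at this
    obtain ⟨a1, a2, a3⟩ := Tw_loc σ p
    obtain ⟨b1, b2, b3⟩ := Tw_loc ρ p
    simp only [a1, a2, a3, b1, b2, b3]
    exact this
  have hnew : ∀ p u, Tw σ p = none → Tw ρ p = some u →
      newOK τ u (fun d => Tw σ (nb p d)) (fun d => Tw ρ (nb p d))
      (Tw σ (nb (nb p .E) .N)) (Tw ρ (nb (nb p .E) .N)) := by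
    intro p u hs hr
    have := hloc p
    rw [hs, hr] at this
    exact this.2
  refine phaseB G0 rqW (fun p => rkW (Tw ρ p))
    (Finset.Icc (-2 : ℤ) 1 ×ˢ Finset.Icc (-3 * M - 5) (3 * M + 5)) ?_ ?_ hst ?_ ?_ ?_ ?_ ?_
  · intro p hp
    obtain ⟨t, ht⟩ := Option.ne_none_iff_exists'.1 hp
    have := hloc p
    rw [ht] at this
    rw [ht]
    exact this
  · rintro ⟨x, y⟩ hp
    have h1 := cell_ne hp
    have h2 : ¬ ((y + 2) / 3 < -M ∨ M < (y + 2) / 3) := by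
      intro h
      apply hp
      simp only [Tw, hM _ h, cell_zero]
    simp only [Finset.mem_product, Finset.mem_Icc]
    simp only at h1
    omega
  · intro p u hs hr
    exact mem_T.2 (hnew p u hs hr).1
  · intro p t hs ht hle
    have := hloc p
    rw [hs] at this
    simp only [quad_eq] at hle
    exact this.1 t (mem_T.1 ht) hle
  · intro C p t hSC hCR hcl hp hR ha d hd
    have hs : Tw σ p = none := by
      by_contra hc
      exact hSC.ne hc hp
    have hn := hnew p t hs hR
    have simple : ∀ d, simpleReq τ t (fun d => Tw σ (nb p d)) (fun d => Tw ρ (nb p d)) d →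
        C (nb p d) ≠ none := by
      intro d hd
      rcases hd with hd | hd
      · exact hSC.ne (isSome_iff.1 hd)
      · refine req_of_lt G0 hCR hcl hp ha d ?_
        simp only [quad_eq]
        exact hd
    rcases hn.2.1 d hd with h | h
    · exact simple d h
    · obtain ⟨rfl, h1, h2, h3, h4, h5⟩ := h
      have e1 := simple _ h1
      have e2 : C (nb p .E) = some ty := by
        rw [← h3]
        exact (hCR _ e1).symm
      have e3 := hcl _ _ h2 e2 .N (by decide)
      have e4 : C (nb (nb p .E) .N) = some tD := by
        rw [← h5]
        exact (hCR _ e3).symm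
      have e5 := hcl _ _ h4 e4 .W (by decide)
      have : nb (nb (nb p .E) .N) .W = nb p .N := by
        simp [nb]
      rwa [this] at e5
  · intro p u hs hr
    have := (hnew p u hs hr).2.2.1
    simpa only [isSome_iff] using this
  · intro p u hs hr d hd
    have := (hnew p u hs hr).2.2.2 d hd
    simp only [isSome_iff] at this
    rw [hr]
    exact this

/-! ## The sequence of tower configurations -/

def fullb (V i : ℕ) : ℕ := if V.testBit i then 9 else 5

def wst (V j s s' : ℕ) (J : ℤ) : ℕ :=
  if J < 0 then 0 else if J = 0 then 6 else if J ≤ j then fullb V (J - 1).toNat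
  else if J = j + 1 then s else if J = j + 2 then s' else 0

lemma wst_succ (V j : ℕ) : wst V j (fullb V j) 1 = wst V (j + 1) 1 0 := by
  funext J
  unfold wst
  push_cast
  split_ifs <;> first | rfl | omega | skip
  have : (J - 1).toNat = j := by omega
  rw [this]

lemma wst_big (V j s s' : ℕ) (J : ℤ) (h : J < -(j + 3 : ℤ) ∨ (j + 3 : ℤ) < J) :
    wst V j s s' J = 0 := by
  unfold wst
  split_ifs <;> first | rfl | omega

lemma wst_neg (V j s s' : ℕ) {J : ℤ} (h : J < 0) : wst V j s s' J = 0 := by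
  simp [wst, h]

lemma wst_zero (V j s s' : ℕ) : wst V j s s' 0 = 6 := by
  simp [wst]

lemma wst_mid (V j s s' : ℕ) {J : ℤ} (h : 0 < J) (h' : J ≤ j) :
    wst V j s s' J = fullb V (J - 1).toNat := by
  rw [wst, if_neg (by omega), if_neg (by omega), if_pos h']

lemma wst_act (V j s s' : ℕ) {J : ℤ} (h : J = j + 1) : wst V j s s' J = s := by
  rw [wst, if_neg (by omega), if_neg (by omega), if_neg (by omega), if_pos h]

lemma wst_nxt (V j s s' : ℕ) {J : ℤ} (h : J = j + 2) : wst V j s s' J = s' := by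
  rw [wst, if_neg (by omega), if_neg (by omega), if_neg (by omega), if_neg (by omega), if_pos h]

lemma wst_hi (V j s s' : ℕ) {J : ℤ} (h : j + 2 < J) : wst V j s s' J = 0 := by
  rw [wst, if_neg (by omega), if_neg (by omega), if_neg (by omega), if_neg (by omega),
    if_neg (by omega)]

lemma wst_adj (V j s s' u u' : ℕ) (J : ℤ) :
    ((wst V j s s' J, wst V j u u' J), (wst V j s s' (J + 1), wst V j u u' (J + 1))) ∈
      adjL (s, u) (s', u') := by
  have hf : ∀ i, fullb V i = 5 ∨ fullb V i = 9 := by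
    intro i
    unfold fullb
    split_ifs <;> simp
  by_cases h1 : J < -1
  · rw [wst_neg _ _ _ _ (by omega), wst_neg _ _ _ _ (by omega), wst_neg _ _ _ _ (by omega),
      wst_neg _ _ _ _ (by omega)]
    simp [adjL]
  by_cases h2 : J = -1
  · subst h2
    rw [wst_neg _ _ _ _ (by omega), wst_neg _ _ _ _ (by omega), neg_add_cancel, wst_zero, wst_zero]
    simp [adjL]
  by_cases h3 : J = 0
  · subst h3
    rw [wst_zero, wst_zero]
    by_cases hj : j = 0
    · rw [wst_act _ _ _ _ (by omega), wst_act _ _ _ _ (by omega)]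
      simp [adjL]
    · rw [wst_mid _ _ _ _ (by omega) (by omega), wst_mid _ _ _ _ (by omega) (by omega)]
      rcases hf (0 + 1 - 1 : ℤ).toNat with h | h <;> rw [h] <;> simp [adjL]
  by_cases h4 : J ≤ j
  · rw [wst_mid _ _ _ _ (by omega) (by omega), wst_mid _ _ _ _ (by omega) (by omega)]
    by_cases h5 : J = j
    · rw [wst_act _ _ _ _ (by omega), wst_act _ _ _ _ (by omega)]
      rcases hf (J - 1 : ℤ).toNat with h | h <;> rw [h] <;> simp [adjL]
    · rw [wst_mid _ _ _ _ (by omega) (by omega), wst_mid _ _ _ _ (by omega) (by omega)]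
      rcases hf (J - 1 : ℤ).toNat with h | h <;> rcases hf (J + 1 - 1 : ℤ).toNat with h' | h' <;>
        rw [h, h'] <;> simp [adjL]
  by_cases h6 : J = j + 1
  · rw [wst_act _ _ _ _ (by omega), wst_act _ _ _ _ (by omega), wst_nxt _ _ _ _ (by omega),
      wst_nxt _ _ _ _ (by omega)]
    simp [adjL]
  by_cases h7 : J = j + 2
  · rw [wst_nxt _ _ _ _ (by omega), wst_nxt _ _ _ _ (by omega), wst_hi _ _ _ _ (by omega),
      wst_hi _ _ _ _ (by omega)]
    simp [adjL]
  · rw [wst_hi _ _ _ _ (by omega), wst_hi _ _ _ _ (by omega), wst_hi _ _ _ _ (by omega),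
      wst_hi _ _ _ _ (by omega)]
    simp [adjL]

/-- First phase. -/
lemma phase0 (V : ℕ) : PhaseTo (Step T G 10) (seedConfig seed) (Tw (wst V 0 1 0)) ∧
    Stable G 10 (Tw (wst V 0 1 0)) := by
  have e1 : seedConfig seed = Tw (fun J => if J = 0 then 7 else 0) := by
    funext ⟨x, y⟩
    simp only [seedConfig, Tw, Prod.mk.injEq]
    by_cases hJ : (y + 2) / 3 = 0
    · rw [if_pos hJ]
      by_cases hx : -2 ≤ x ∧ x ≤ 1
      · obtain ⟨hx1, hx2⟩ := hx
        have hy1 : -2 ≤ y := by omega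
        have hy2 : y ≤ 0 := by omega
        interval_cases x <;> interval_cases y <;> decide
      · rw [if_neg (by omega)]
        by_contra hc
        exact hx (cell_ne (fun h => hc h.symm))
    · rw [if_neg hJ, cell_zero, if_neg (by omega)]
  have e2 : wst V 0 1 0 = fun J => if J = 0 then 6 else if J = 1 then 1 else 0 := by
    funext J
    simp only [wst]
    push_cast
    split_ifs <;> first | rfl | omega
  have hst : Stable G 10 (seedConfig seed) := by
    intro Q ⟨q, hq⟩ h0 hQ
    exfalso
    have := hQ q hq
    simp only [seedConfig] at this
    split_ifs at this with h
    · rw [h] at hq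
      exact h0 hq
    · exact this rfl
  rw [e2]
  rw [e1] at hst ⊢
  refine towerPhase chk0 _ _ ?_ 3 ?_ hst
  · intro J
    by_cases a : J < -1
    · simp [show ¬ J = 0 by omega, show ¬ J = 1 by omega, show ¬ J + 1 = 0 by omega]
    by_cases a' : 1 < J
    · simp [show ¬ J = 0 by omega, show ¬ J = 1 by omega, show ¬ J + 1 = 0 by omega]
    have : J = -1 ∨ J = 0 ∨ J = 1 := by omega
    rcases this with rfl | rfl | rfl <;> simp
  · intro J hJ
    rw [if_neg (by omega), if_neg (by omega)]

lemma phaseV0 (V j : ℕ) (h : Stable G 10 (Tw (wst V j 1 0))) :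
    PhaseTo (Step T G 7) (Tw (wst V j 1 0)) (Tw (wst V j 2 0)) :=
  (towerPhase chkV0 _ _ (wst_adj V j 1 0 2 0) (j + 3) (wst_big V j 2 0) (h.mono (by norm_num))).1

lemma phaseV1 (V j : ℕ) (h : Stable G 10 (Tw (wst V j 1 0))) :
    PhaseTo (Step T G 6) (Tw (wst V j 1 0)) (Tw (wst V j 8 0)) ∧
      Stable G 6 (Tw (wst V j 8 0)) :=
  towerPhase chkV1 _ _ (wst_adj V j 1 0 8 0) (j + 3) (wst_big V j 8 0) (h.mono (by norm_num))

lemma phaseW0 (V j : ℕ) (h : Stable G 10 (Tw (wst V j 3 0))) :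
    PhaseTo (Step T G 10) (Tw (wst V j 3 0)) (Tw (wst V j 5 1)) ∧
      Stable G 10 (Tw (wst V j 5 1)) :=
  towerPhase chkW0 _ _ (wst_adj V j 3 0 5 1) (j + 3) (wst_big V j 5 1) h

lemma phaseW1 (V j : ℕ) (h : Stable G 10 (Tw (wst V j 10 0))) :
    PhaseTo (Step T G 10) (Tw (wst V j 10 0)) (Tw (wst V j 9 1)) ∧
      Stable G 10 (Tw (wst V j 9 1)) :=
  towerPhase chkW1 _ _ (wst_adj V j 10 0 9 1) (j + 3) (wst_big V j 9 1) h



/-! ## The volatile stages -/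

lemma sum4_two (f : Dir → ℕ) {d e : Dir} (h : d ≠ e) : f d + f e ≤ sum4 f := by
  unfold sum4
  cases d <;> cases e <;> first | exact absurd rfl h | omega

lemma stable_pair {τ : ℕ} {S C : Config} (hS : Stable G τ S)
    (h : Extn S C) (p : ℤ × ℤ) (d e f : Dir) (hSp : S p = none) (hSq : S (nb p d) = none)
    (hnew : ∀ r, C r ≠ none → S r = none → r = p ∨ r = nb p d)
    (he : S (nb p e) ≠ none) (hf : S (nb (nb p d) f) ≠ none)
    (h1 : τ ≤ bd G C p d + bd G C p e)
    (h2 : τ ≤ bd G C (nb p d) (opp d) + bd G C (nb p d) f)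
    (h3 : τ ≤ bd G C p e + bd G C (nb p d) f) : Stable G τ C := by
  have hde : d ≠ e := by
    rintro rfl
    exact he hSq
  have hdf : opp d ≠ f := by
    rintro rfl
    rw [nb_opp] at hf
    exact hf hSp
  refine stable_extend G0 hS h fun Q hne hQ => ?_
  have hin : ∀ r, S r ≠ none → r ∉ Q := fun r hr hq => hr (hQ r hq).2
  have hpq : nb p d ≠ p := nb_ne p d
  have term : ∀ r ∈ Q, (sum4 fun d => if nb r d ∈ Q then 0 else bd G C r d) ≤ cut G C Q := by
    intro r hr
    exact Finset.single_le_sum (f := fun r => sum4 fun d => if nb r d ∈ Q then 0 else bd G C r d)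
      (fun _ _ => Nat.zero_le _) hr
  by_cases hp : p ∈ Q
  · by_cases hq : nb p d ∈ Q
    · have hQe : ({p, nb p d} : Finset (ℤ × ℤ)) ⊆ Q := by
        intro r hr
        simp only [Finset.mem_insert, Finset.mem_singleton] at hr
        rcases hr with rfl | rfl <;> assumption
      have := Finset.sum_le_sum_of_subset hQe
        (f := fun r => sum4 fun d => if nb r d ∈ Q then 0 else bd G C r d)
      rw [Finset.sum_pair hpq.symm] at this
      refine le_trans ?_ this
      refine h3.trans (Nat.add_le_add ?_ ?_)
      · refine le_trans ?_ (le_trans (Nat.le_add_left _ _) (sum4_two _ hde))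
        rw [if_neg (hin _ he)]
      · refine le_trans ?_ (le_trans (Nat.le_add_left _ _) (sum4_two _ hdf))
        rw [if_neg (hin _ hf)]
    · refine le_trans ?_ ((sum4_two _ hde).trans (term p hp))
      rwa [if_neg hq, if_neg (hin _ he)]
  · have hq : nb p d ∈ Q := by
      obtain ⟨r, hr⟩ := hne
      rcases hnew r (hQ r hr).1 (hQ r hr).2 with rfl | rfl
      · exact absurd hr hp
      · exact hr
    refine le_trans ?_ ((sum4_two _ hdf).trans (term _ hq))
    rwa [nb_opp, if_neg hp, if_neg (hin _ hf)]

lemma Tw_act (V j s s' : ℕ) (x : ℤ) {r : ℤ} (h : 0 ≤ r ∧ r ≤ 2) :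
    Tw (wst V j s s') (x, 3 * j + 1 + r) = cell s x r := by
  have h1 : (3 * (j : ℤ) + 1 + r + 2) / 3 = j + 1 := by omega
  have h2 : (3 * (j : ℤ) + 1 + r + 2) % 3 = r := by omega
  simp only [Tw, h1, h2]
  rw [wst_act _ _ _ _ rfl]

lemma Tw_out (V j s t s' : ℕ) {p : ℤ × ℤ} (h : (p.2 + 2) / 3 ≠ j + 1) :
    Tw (wst V j s s') p = Tw (wst V j t s') p := by
  simp only [Tw, wst, if_neg h]

lemma act_form (j : ℕ) {p : ℤ × ℤ} (h : (p.2 + 2) / 3 = j + 1) :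
    ∃ x r : ℤ, 0 ≤ r ∧ r ≤ 2 ∧ p = (x, 3 * j + 1 + r) :=
  ⟨p.1, p.2 - 3 * j - 1, by omega, by omega, by ext <;> simp⟩

lemma bd_act (V j s s' : ℕ) (x r : ℤ) (h : 0 ≤ r ∧ r ≤ 2) (d : Dir)
    (h' : 0 ≤ (nb (x, r) d).2 ∧ (nb (x, r) d).2 ≤ 2) :
    bd G (Tw (wst V j s s')) (x, 3 * j + 1 + r) d =
      bond G (face (cell s x r) d) (face (cell s (nb (x, r) d).1 (nb (x, r) d).2) (opp d)) := by
  have : nb (x, 3 * (j : ℤ) + 1 + r) d = ((nb (x, r) d).1, 3 * j + 1 + (nb (x, r) d).2) := by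
    cases d <;> simp [nb] <;> ring
  rw [bd, this, Tw_act _ _ _ _ _ h, Tw_act _ _ _ _ _ h']

def xs4 : List ℤ := [-2, -1, 0, 1]

lemma mem_xs4 {x : ℤ} (h1 : -2 ≤ x) (h2 : x ≤ 1) : x ∈ xs4 := by
  interval_cases x <;> decide

lemma mem_rs {r : ℤ} (h1 : 0 ≤ r) (h2 : r ≤ 2) : r ∈ rs := by
  interval_cases r <;> decide

lemma ext_act (V j s t : ℕ)
    (h : ∀ x ∈ xs4, ∀ r ∈ rs, cell s x r ≠ none → cell t x r = cell s x r) :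
    Extn (Tw (wst V j s 0)) (Tw (wst V j t 0)) := by
  intro p hp
  by_cases hJ : (p.2 + 2) / 3 = j + 1
  · obtain ⟨x, r, h0, h2, rfl⟩ := act_form j hJ
    rw [Tw_act _ _ _ _ _ ⟨h0, h2⟩] at hp ⊢
    rw [Tw_act _ _ _ _ _ ⟨h0, h2⟩]
    exact h x (mem_xs4 (cell_ne hp).1 (cell_ne hp).2) r (mem_rs h0 h2) hp
  · exact Tw_out V j t s 0 hJ

lemma new_act (V j s t : ℕ) {p : ℤ × ℤ} (h1 : Tw (wst V j t 0) p ≠ none)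
    (h2 : Tw (wst V j s 0) p = none) :
    ∃ x ∈ xs4, ∃ r ∈ rs, cell t x r ≠ none ∧ cell s x r = none ∧ p = (x, 3 * j + 1 + r) := by
  by_cases hJ : (p.2 + 2) / 3 = j + 1
  · obtain ⟨x, r, h0, h3, rfl⟩ := act_form j hJ
    rw [Tw_act _ _ _ _ _ ⟨h0, h3⟩] at h1 h2
    exact ⟨x, mem_xs4 (cell_ne h1).1 (cell_ne h1).2, r, mem_rs h0 h3, h1, h2, rfl⟩
  · rw [Tw_out V j t s 0 hJ] at h1
    exact absurd h2 h1

lemma stable3 (V j : ℕ) (h : Stable G 10 (Tw (wst V j 1 0))) :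
    Stable G 10 (Tw (wst V j 3 0)) := by
  have e1 : nb ((0 : ℤ), 3 * (j : ℤ) + 1 + 1) .W = ((-1 : ℤ), 3 * (j : ℤ) + 1 + 1) := rfl
  have e2 : nb ((0 : ℤ), 3 * (j : ℤ) + 1 + 1) .S = ((0 : ℤ), 3 * (j : ℤ) + 1 + 0) := by simp [nb]
  have e3 : nb ((-1 : ℤ), 3 * (j : ℤ) + 1 + 1) .S = ((-1 : ℤ), 3 * (j : ℤ) + 1 + 0) := by simp [nb]
  refine stable_pair h (ext_act V j 1 3 (by decide)) (0, 3 * j + 1 + 1) .W .S .S ?_ ?_ ?_ ?_ ?_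
    ?_ ?_ ?_
  · rw [Tw_act _ _ _ _ _ (by decide)]; decide
  · rw [e1, Tw_act _ _ _ _ _ (by decide)]; decide
  · intro r hr1 hr2
    obtain ⟨x, hx, r, hr, h1, h2, rfl⟩ := new_act V j 1 3 hr1 hr2
    have : ∀ x ∈ xs4, ∀ r ∈ rs, cell 3 x r ≠ none → cell 1 x r = none →
      (x = 0 ∧ r = 1) ∨ (x = -1 ∧ r = 1) := by decide
    rcases this x hx r hr h1 h2 with ⟨rfl, rfl⟩ | ⟨rfl, rfl⟩
    · exact Or.inl rfl
    · exact Or.inr rfl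
  · rw [e2, Tw_act _ _ _ _ _ (by decide)]; decide
  · rw [e1, e3, Tw_act _ _ _ _ _ (by decide)]; decide
  · rw [bd_act _ _ _ _ _ _ (by decide) _ (by decide), bd_act _ _ _ _ _ _ (by decide) _ (by decide)]
    decide
  · rw [e1, bd_act _ _ _ _ _ _ (by decide) _ (by decide),
      bd_act _ _ _ _ _ _ (by decide) _ (by decide)]
    decide
  · rw [e1, bd_act _ _ _ _ _ _ (by decide) _ (by decide),
      bd_act _ _ _ _ _ _ (by decide) _ (by decide)]
    decide

lemma stable10 (V j : ℕ) (h : Stable G 10 (Tw (wst V j 1 0))) :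
    Stable G 10 (Tw (wst V j 10 0)) := by
  have e1 : nb ((1 : ℤ), 3 * (j : ℤ) + 1 + 0) .N = ((1 : ℤ), 3 * (j : ℤ) + 1 + 1) := by simp [nb]
  have e2 : nb ((1 : ℤ), 3 * (j : ℤ) + 1 + 0) .W = ((0 : ℤ), 3 * (j : ℤ) + 1 + 0) := rfl
  have e3 : nb ((1 : ℤ), 3 * (j : ℤ) + 1 + 1) .W = ((0 : ℤ), 3 * (j : ℤ) + 1 + 1) := rfl
  refine stable_pair (stable3 V j h) (ext_act V j 3 10 (by decide)) (1, 3 * j + 1 + 0) .N .W .W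
    ?_ ?_ ?_ ?_ ?_ ?_ ?_ ?_
  · rw [Tw_act _ _ _ _ _ (by decide)]; decide
  · rw [e1, Tw_act _ _ _ _ _ (by decide)]; decide
  · intro r hr1 hr2
    obtain ⟨x, hx, r, hr, h1, h2, rfl⟩ := new_act V j 3 10 hr1 hr2
    have : ∀ x ∈ xs4, ∀ r ∈ rs, cell 10 x r ≠ none → cell 3 x r = none →
      (x = 1 ∧ r = 0) ∨ (x = 1 ∧ r = 1) := by decide
    rcases this x hx r hr h1 h2 with ⟨rfl, rfl⟩ | ⟨rfl, rfl⟩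
    · exact Or.inl rfl
    · exact Or.inr e1.symm
  · rw [e2, Tw_act _ _ _ _ _ (by decide)]; decide
  · rw [e1, e3, Tw_act _ _ _ _ _ (by decide)]; decide
  · rw [bd_act _ _ _ _ _ _ (by decide) _ (by decide), bd_act _ _ _ _ _ _ (by decide) _ (by decide)]
    decide
  · rw [e1, bd_act _ _ _ _ _ _ (by decide) _ (by decide),
      bd_act _ _ _ _ _ _ (by decide) _ (by decide)]
    decide
  · rw [e1, bd_act _ _ _ _ _ _ (by decide) _ (by decide),
      bd_act _ _ _ _ _ _ (by decide) _ (by decide)]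
    decide

lemma chkN2 : Chk 10 (adjL (2, 2) (0, 0)) := by decide +kernel
lemma chkN8 : Chk 10 (adjL (8, 8) (0, 0)) := by decide +kernel
lemma chkN4 : Chk 10 (adjL (4, 4) (0, 0)) := by decide +kernel
lemma chkN11 : Chk 10 (adjL (11, 11) (0, 0)) := by decide +kernel

lemma no_attach {τ : ℕ} {adj : List ((ℕ × ℕ) × (ℕ × ℕ))} (hchk : Chk τ adj)
    (σ : ℤ → ℕ) (hadj : ∀ J, ((σ J, σ J), (σ (J + 1), σ (J + 1))) ∈ adj) (p : ℤ × ℤ) (t : Tile)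
    (ht : t ∈ T) (hp : Tw σ p = none) : att G (Tw σ) t p < τ := by
  by_contra hc
  have h1 := hadj ((p.2 + 2) / 3 - 1)
  rw [sub_add_cancel] at h1
  have := hchk _ h1 _ (hadj ((p.2 + 2) / 3)) rfl _ (clamp_mem p.1) _ (mod_mem p.2)
  unfold ChkOK at this
  obtain ⟨a1, a2, a3⟩ := Tw_loc σ p
  simp only [← a1, ← a2, ← a3] at this
  rw [hp] at this
  have h2 := this.1 t (mem_T.1 ht) ?_
  · simp at h2
  · refine (not_lt.1 hc).trans (sum4_le fun d => ?_)
    cases hn : Tw σ (nb p d) with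
    | none => simp [face, bond_zero G0]
    | some u => simp [quadL, face, hn]

lemma remove_act (V j s a : ℕ) (Q : Finset (ℤ × ℤ))
    (h1 : ∀ x ∈ xs4, ∀ r ∈ rs, cell a x r =
      if (x, 3 * (j : ℤ) + 1 + r) ∈ Q then none else cell s x r)
    (h2 : ∀ q ∈ Q, (q.2 + 2) / 3 = j + 1) :
    (fun q => if q ∈ Q then none else Tw (wst V j s 0) q) = Tw (wst V j a 0) := by
  funext q
  by_cases hJ : (q.2 + 2) / 3 = j + 1
  · obtain ⟨x, r, h0, h3, rfl⟩ := act_form j hJ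
    rw [Tw_act _ _ _ _ _ ⟨h0, h3⟩, Tw_act _ _ _ _ _ ⟨h0, h3⟩]
    by_cases hx : -2 ≤ x ∧ x ≤ 1
    · exact (h1 x (mem_xs4 hx.1 hx.2) r (mem_rs h0 h3)).symm
    · have hn : ∀ s, cell s x r = none := by
        intro s
        by_contra hc
        exact hx (cell_ne hc)
      rw [hn, hn, ite_self]
  · rw [if_neg (fun h => hJ (h2 q h))]
    exact Tw_out V j s a 0 hJ

/-- Removal of the volatile tiles: first `tD`, or `tB` and `tD` together. -/
lemma fall {V j s a b : ℕ} {R : Config}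
    (hs : ∀ x ∈ xs4, ∀ r ∈ rs, cell a x r = if x = 0 ∧ r = 2 then none else cell s x r)
    (ha : ∀ x ∈ xs4, ∀ r ∈ rs, cell b x r = if x = -1 ∧ r = 2 then none else cell a x r)
    (h5 : cell s (-2) 2 = some x5) (hB : cell s (-1) 2 = some tB) (hD : cell s 0 2 = some tD)
    (hy : cell s 0 1 = some ty) (he : cell s 1 2 = none) (hg : cell s (-1) 1 = some tg)
    (hNs : Chk 10 (adjL (s, s) (0, 0))) (hNa : Chk 10 (adjL (a, a) (0, 0)))
    (hst : Stable G 10 (Tw (wst V j b 0)))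
    (hR : PhaseTo (Step T G 10) (Tw (wst V j b 0)) R) :
    PhaseTo (Step T G 10) (Tw (wst V j s 0)) R := by
  have a5 : cell a (-2) 2 = some x5 := by rw [hs _ (by decide) _ (by decide), ← h5]; rfl
  have aB : cell a (-1) 2 = some tB := by rw [hs _ (by decide) _ (by decide), ← hB]; rfl
  have ag : cell a (-1) 1 = some tg := by rw [hs _ (by decide) _ (by decide), ← hg]; rfl
  have aD : cell a 0 2 = none := by rw [hs _ (by decide) _ (by decide)]; rfl
  have hba : ∀ x ∈ xs4, ∀ r ∈ rs, cell b x r ≠ none → cell a x r = cell b x r := by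
    intro x hx r hr h
    rw [ha x hx r hr] at h ⊢
    split_ifs at h ⊢ with hc
    · exact absurd rfl h
    · rfl
  have hbs : ∀ x ∈ xs4, ∀ r ∈ rs, cell b x r ≠ none → cell s x r = cell b x r := by
    intro x hx r hr h
    have h1 := hba x hx r hr h
    rw [← h1] at h ⊢
    rw [hs x hx r hr] at h ⊢
    split_ifs at h ⊢ with hc
    · exact absurd rfl h
    · rfl
  set pB : ℤ × ℤ := (-1, 3 * (j : ℤ) + 1 + 2) with hpB
  set pD : ℤ × ℤ := (0, 3 * (j : ℤ) + 1 + 2) with hpD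
  have neBD : pB ≠ pD := by simp [hpB, hpD]
  have hN : ∀ (s : ℕ) (x : ℤ), bd G (Tw (wst V j s 0)) (x, 3 * (j : ℤ) + 1 + 2) .N = 0 := by
    intro s x
    have : Tw (wst V j s 0) (nb (x, 3 * (j : ℤ) + 1 + 2) .N) = none := by
      have h1 : (3 * (j : ℤ) + 1 + 2 + 1 + 2) / 3 = j + 2 := by omega
      simp only [nb, Tw, h1]
      rw [wst_nxt _ _ _ _ rfl, cell_zero]
    rw [bd, this]
    exact bond_zero G0 _
  have hQsub : ∀ c, (∀ x ∈ xs4, ∀ r ∈ rs, cell b x r ≠ none → cell c x r = cell b x r) →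
      ∀ Q : Finset (ℤ × ℤ), ((0, 0) : ℤ × ℤ) ∉ Q →
      cut G (Tw (wst V j c 0)) Q < 10 → ∀ q ∈ Q, Tw (wst V j b 0) q = none := by
    intro c hc Q h0 hcut q hq
    by_contra hne
    have := cut_mono G0 (ext_act V j b c hc) Q
    have h2 := hst _ ⟨q, Finset.mem_filter.2 ⟨hq, hne⟩⟩ (fun h => h0 (Finset.mem_filter.1 h).1)
      (fun q hq => (Finset.mem_filter.1 hq).2)
    omega
  have hQpos : ∀ Q : Finset (ℤ × ℤ), (∀ q ∈ Q, Tw (wst V j s 0) q ≠ none) →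
      (∀ q ∈ Q, Tw (wst V j b 0) q = none) → ∀ q ∈ Q, q = pB ∨ q = pD := by
    intro Q h1 h2 q hq
    obtain ⟨x, hx, r, hr, e1, e2, rfl⟩ := new_act V j b s (h1 q hq) (h2 q hq)
    rw [ha x hx r hr, hs x hx r hr] at e2
    split_ifs at e2 with c1 c2
    · exact Or.inl (by rw [c1.1, c1.2])
    · exact Or.inr (by rw [c2.1, c2.2])
    · exact absurd e2 e1
  have row : ∀ x : ℤ, (3 * (j : ℤ) + 1 + 2 + 2) / 3 = j + 1 := by intro x; omega
  have mB : ∀ x r : ℤ, (x, 3 * (j : ℤ) + 1 + r) = pB ↔ x = -1 ∧ r = 2 := by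
    intro x r
    simp [hpB]
  have mD : ∀ x r : ℤ, (x, 3 * (j : ℤ) + 1 + r) = pD ↔ x = 0 ∧ r = 2 := by
    intro x r
    simp [hpD]
  have remD : (fun q => if q ∈ ({pD} : Finset (ℤ × ℤ)) then none else Tw (wst V j s 0) q) =
      Tw (wst V j a 0) := by
    refine remove_act V j s a _ ?_ ?_
    · intro x hx r hr
      simp only [Finset.mem_singleton, mD]
      exact hs x hx r hr
    · intro q hq
      rw [Finset.mem_singleton.1 hq]
      exact row 0
  have remBD : (fun q => if q ∈ ({pB, pD} : Finset (ℤ × ℤ)) then none else Tw (wst V j s 0) q) =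
      Tw (wst V j b 0) := by
    refine remove_act V j s b _ ?_ ?_
    · intro x hx r hr
      simp only [Finset.mem_insert, Finset.mem_singleton, mD, mB]
      rw [ha x hx r hr, hs x hx r hr]
      split_ifs <;> first | rfl | tauto
    · intro q hq
      rcases Finset.mem_insert.1 hq with h | h
      · rw [h]; exact row 0
      · rw [Finset.mem_singleton.1 h]; exact row 0
  have remB : (fun q => if q ∈ ({pB} : Finset (ℤ × ℤ)) then none else Tw (wst V j a 0) q) =
      Tw (wst V j b 0) := by
    refine remove_act V j a b _ ?_ ?_
    · intro x hx r hr
      simp only [Finset.mem_singleton, mB]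
      exact ha x hx r hr
    · intro q hq
      rw [Finset.mem_singleton.1 hq]
      exact row 0
  have orig : ∀ x : ℤ, ((0, 0) : ℤ × ℤ) ≠ (x, 3 * (j : ℤ) + 1 + 2) := by
    intro x h
    have := congrArg Prod.snd h
    simp only at this
    omega
  -- values of the bonds
  have bDW : bd G (Tw (wst V j s 0)) pD .W = 7 := by
    rw [bd_act _ _ _ _ _ _ (by decide) _ (by decide)]
    simp only [nb]
    norm_num
    rw [hB, hD]; decide
  have bDS : bd G (Tw (wst V j s 0)) pD .S = 2 := by
    rw [bd_act _ _ _ _ _ _ (by decide) _ (by decide)]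
    simp only [nb]
    norm_num
    rw [hD, hy]; decide
  have bDE : bd G (Tw (wst V j s 0)) pD .E = 0 := by
    rw [bd_act _ _ _ _ _ _ (by decide) _ (by decide)]
    simp only [nb]
    norm_num
    rw [hD, he]; decide
  have bBW : bd G (Tw (wst V j s 0)) pB .W = 7 := by
    rw [bd_act _ _ _ _ _ _ (by decide) _ (by decide)]
    simp only [nb]
    norm_num
    rw [hB, h5]; decide
  have bBE : bd G (Tw (wst V j s 0)) pB .E = 7 := by
    rw [bd_act _ _ _ _ _ _ (by decide) _ (by decide)]
    simp only [nb]
    norm_num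
    rw [hB, hD]; decide
  have aBW : bd G (Tw (wst V j a 0)) pB .W = 7 := by
    rw [bd_act _ _ _ _ _ _ (by decide) _ (by decide)]
    simp only [nb]
    norm_num
    rw [aB, a5]; decide
  have aBE : bd G (Tw (wst V j a 0)) pB .E = 0 := by
    rw [bd_act _ _ _ _ _ _ (by decide) _ (by decide)]
    simp only [nb]
    norm_num
    rw [aB, aD]; decide
  have aBS : bd G (Tw (wst V j a 0)) pB .S = 0 := by
    rw [bd_act _ _ _ _ _ _ (by decide) _ (by decide)]
    simp only [nb]
    norm_num
    rw [aB, ag]; decide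
  have single : ∀ C p, cut G C {p} = sum4 (bd G C p) := by
    intro C p
    simp only [cut, Finset.sum_singleton, Finset.mem_singleton, nb_ne, if_false]
  have cutD : cut G (Tw (wst V j s 0)) {pD} = 9 := by
    rw [single, sum4, hN, bDE, bDS, bDW]
  have cutB : 14 ≤ cut G (Tw (wst V j s 0)) {pB} := by
    rw [single]
    have := sum4_two (bd G (Tw (wst V j s 0)) pB) (d := .W) (e := .E) (by decide)
    omega
  have cutBa : cut G (Tw (wst V j a 0)) {pB} = 7 := by
    rw [single, sum4, hN, aBE, aBS, aBW]
  have phase_a : PhaseTo (Step T G 10) (Tw (wst V j a 0)) R := by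
    refine phase_step ⟨_, Step.detach _ {pB} ⟨pB, by simp⟩ (fun h => orig _ (Finset.mem_singleton.1 h)) ?_ ?_⟩ ?_
    · intro q hq
      simp only [Finset.coe_singleton, Set.mem_singleton_iff] at hq
      change Tw (wst V j a 0) q ≠ none
      rw [hq, hpB, Tw_act _ _ _ _ _ (by decide), aB]
      simp
    · rw [cutStrength_eq G0, cutBa]
      norm_num
    · intro D hstep
      cases hstep with
      | attach t p ht hp hatt =>
        rw [attachStrength_eq G0] at hatt
        exact absurd (no_attach hNa _ (wst_adj V j a 0 a 0) p t ht hp) (not_lt.2 hatt)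
      | detach Q hne h0 hQ hcut =>
        rw [cutStrength_eq G0] at hcut
        have hb := hQsub a hba Q h0 hcut
        have : Q = {pB} := by
          refine Finset.eq_singleton_iff_nonempty_unique_mem.2 ⟨hne, fun q hq => ?_⟩
          have hqa : Tw (wst V j a 0) q ≠ none := hQ hq
          obtain ⟨x, hx, r, hr, e1, e2, rfl⟩ := new_act V j b a hqa (hb q hq)
          rw [ha x hx r hr] at e2
          split_ifs at e2 with c1
          · rw [c1.1, c1.2]
          · exact absurd e2 e1
        rw [this, remB]
        exact hR
  refine phase_step ⟨_, Step.detach _ {pD} ⟨pD, by simp⟩ (fun h => orig _ (Finset.mem_singleton.1 h)) ?_ ?_⟩ ?_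
  · intro q hq
    simp only [Finset.coe_singleton, Set.mem_singleton_iff] at hq
    change Tw (wst V j s 0) q ≠ none
    rw [hq, hpD, Tw_act _ _ _ _ _ (by decide), hD]
    simp
  · rw [cutStrength_eq G0, cutD]
    norm_num
  · intro D hstep
    cases hstep with
    | attach t p ht hp hatt =>
      rw [attachStrength_eq G0] at hatt
      exact absurd (no_attach hNs _ (wst_adj V j s 0 s 0) p t ht hp) (not_lt.2 hatt)
    | detach Q hne h0 hQ hcut =>
      rw [cutStrength_eq G0] at hcut
      have hb := hQsub s hbs Q h0 hcut
      have hpos := hQpos Q (fun q hq => hQ hq) hb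
      by_cases hBQ : pB ∈ Q
      · by_cases hDQ : pD ∈ Q
        · have : Q = {pB, pD} := by
            ext q
            simp only [Finset.mem_insert, Finset.mem_singleton]
            constructor
            · exact hpos q
            · rintro (rfl | rfl) <;> assumption
          rw [this, remBD]
          exact hR
        · have : Q = {pB} := by
            refine Finset.eq_singleton_iff_nonempty_unique_mem.2 ⟨hne, fun q hq => ?_⟩
            rcases hpos q hq with h | h
            · exact h
            · rw [h] at hq
              exact absurd hq hDQ
          rw [this] at hcut
          omega
      · have : Q = {pD} := by
          refine Finset.eq_singleton_iff_nonempty_unique_mem.2 ⟨hne, fun q hq => ?_⟩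
          rcases hpos q hq with h | h
          · rw [h] at hq
            exact absurd hq hBQ
          · exact h
        rw [this, remD]
        exact phase_a

lemma phaseF0 (V j : ℕ) (h : Stable G 10 (Tw (wst V j 1 0))) :
    PhaseTo (Step T G 10) (Tw (wst V j 2 0)) (Tw (wst V j 5 1)) :=
  fall (a := 4) (b := 3) (by decide) (by decide) rfl rfl rfl rfl rfl rfl chkN2 chkN4
    (stable3 V j h) (phaseW0 V j (stable3 V j h)).1

lemma phaseF1 (V j : ℕ) (h : Stable G 10 (Tw (wst V j 1 0))) :
    PhaseTo (Step T G 10) (Tw (wst V j 8 0)) (Tw (wst V j 9 1)) :=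
  fall (a := 11) (b := 10) (by decide) (by decide) rfl rfl rfl rfl rfl rfl chkN8 chkN11
    (stable10 V j h) (phaseW1 V j (stable10 V j h)).1

/-- The temperature list that writes `k` blocks starting with block `j`. -/
def wtemps (V : ℕ) : ℕ → ℕ → List ℕ
  | _, 0 => []
  | j, k + 1 => (if V.testBit j then 6 else 7) :: 10 :: wtemps V (j + 1) k

lemma writer (V k : ℕ) : ∀ j τs R, Stable G 10 (Tw (wst V j 1 0)) →
    (Stable G 10 (Tw (wst V (j + k) 1 0)) → Good (Step T G) τs (Tw (wst V (j + k) 1 0)) R) →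
    Good (Step T G) (wtemps V j k ++ τs) (Tw (wst V j 1 0)) R := by
  induction k with
  | zero => intro j τs R h hg; exact hg h
  | succ k ih =>
    intro j τs R h hg
    have hnext : Stable G 10 (Tw (wst V (j + 1) 1 0)) →
        Good (Step T G) (wtemps V (j + 1) k ++ τs) (Tw (wst V (j + 1) 1 0)) R := by
      intro h'
      refine ih (j + 1) τs R h' ?_
      rw [show j + 1 + k = j + (k + 1) by ring]
      exact hg
    rw [← wst_succ] at hnext
    simp only [wtemps, List.cons_append, fullb] at hnext ⊢
    split_ifs at hnext ⊢
    · exact good_cons (phaseV1 V j h).1 (good_cons (phaseF1 V j h)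
        (hnext (phaseW1 V j (stable10 V j h)).2))
    · exact good_cons (phaseV0 V j h) (good_cons (phaseF0 V j h)
        (hnext (phaseW0 V j (stable3 V j h)).2))

lemma wtemps_len (V k : ℕ) : ∀ j, (wtemps V j k).length = 2 * k := by
  induction k with
  | zero => intro j; rfl
  | succ k ih => intro j; simp only [wtemps, List.length_cons, ih]; ring

lemma wtemps_mem (V k : ℕ) : ∀ j, ∀ τ ∈ wtemps V j k, 1 ≤ τ ∧ τ ≤ 10 := by
  induction k with
  | zero => intro j τ h; simp [wtemps] at h
  | succ k ih =>
    intro j τ h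
    simp only [wtemps, List.mem_cons] at h
    rcases h with h | h | h
    · split_ifs at h <;> omega
    · omega
    · exact ih _ _ h



/-! ## The final phase -/

def bt (V : ℕ) (x y : ℤ) : Bool := (V + ((x - 1) / 2).toNat).testBit ((y - 1) / 3).toNat

def cy (V : ℕ) (x y : ℤ) : Bool :=
  decide ((V + ((x - 2) / 2).toNat) % 2 ^ ((y + 2) / 3).toNat = 2 ^ ((y + 2) / 3).toNat - 1)

def hE (V k m : ℕ) (x y : ℤ) : ℕ :=
  if 3 * k + 3 < y then
    if y - (3 * k + 3) - 1 < 2 * m + 2 - x - 1 then 36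
    else if 2 * m + 2 - x - 1 = y - (3 * k + 3) - 1 then 37 else 35
  else if 2 * m + 2 ≤ x then
    if 3 * k + 3 - y = x - (2 * m + 2) then 33
    else if x - (2 * m + 2) < 3 * k + 3 - y then 32 else 34
  else if 1 ≤ x then
    if y = 3 * k + 3 then
      if x % 2 = 0 then 29 else if x = 2 * m + 1 then 31 else 24
    else if y ≤ 0 then
      if x % 2 = 0 then 30 else 28
    else if y % 3 = 1 then (if bt V x y then 26 else 25) else 27
  else if x = 0 ∧ y = 3 * k + 3 then 23 else 0

def vE (V k m : ℕ) (x y : ℤ) : ℕ :=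
  if 2 * m + 2 < x then
    if x - (2 * m + 2) < 3 * k + 3 - y then 40
    else if 3 * k + 3 - y = x - (2 * m + 2) then 41 else 47
  else if 3 * k + 3 ≤ y then
    if y - (3 * k + 3) < 2 * m + 2 - x then 44
    else if 2 * m + 2 - x = y - (3 * k + 3) then 45 else 46
  else if y < 0 then 0
  else if x = 2 * m + 2 then 39
  else if x ≤ 1 then 0
  else if x % 2 = 0 then 38
  else if cy V x y then 43 else 42

def tl (V k m : ℕ) (p : ℤ × ℤ) : Tile :=
  ⟨vE V k m p.1 p.2, hE V k m p.1 p.2, vE V k m p.1 (p.2 - 1), hE V k m (p.1 - 1) p.2⟩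

def rqF (t : Tile) : Dir → Bool
  | .N => decide (38 ≤ t.north ∧ t.north ≤ 41)
  | .S => decide (42 ≤ t.south)
  | .W => decide (23 ≤ t.west ∧ t.west ≤ 35)
  | .E => decide (36 ≤ t.east)

lemma hE_range (V k m : ℕ) (x y : ℤ) : hE V k m x y = 0 ∨ 23 ≤ hE V k m x y ∧ hE V k m x y ≤ 37 := by
  unfold hE
  split_ifs <;> simp

lemma vE_range (V k m : ℕ) (x y : ℤ) : vE V k m x y = 0 ∨ 38 ≤ vE V k m x y ∧ vE V k m x y ≤ 47 := by
  unfold vE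
  split_ifs <;> simp

lemma carry_zero (N : ℕ) : N % 2 ^ 0 = 2 ^ 0 - 1 := by
  simp [Nat.mod_one]

lemma mod_split (N j : ℕ) : N % 2 ^ (j + 1) = N % 2 ^ j + 2 ^ j * (if N.testBit j then 1 else 0) := by
  rw [pow_succ, Nat.mod_mul, Nat.testBit_eq_decide_div_mod_eq]
  have : N / 2 ^ j % 2 < 2 := Nat.mod_lt _ (by norm_num)
  congr 2
  by_cases h : N / 2 ^ j % 2 = 1
  · simp [h]
  · simp [h]
    omega

lemma carry_succ (N j : ℕ) : N % 2 ^ (j + 1) = 2 ^ (j + 1) - 1 ↔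
    (N.testBit j = true ∧ N % 2 ^ j = 2 ^ j - 1) := by
  rw [mod_split, pow_succ]
  have h1 : N % 2 ^ j < 2 ^ j := Nat.mod_lt _ (by positivity)
  have h2 : 0 < 2 ^ j := by positivity
  by_cases h : N.testBit j <;> simp [h] <;> omega

lemma bit_succ (N j : ℕ) : (N + 1).testBit j =
    if N % 2 ^ j = 2 ^ j - 1 then !N.testBit j else N.testBit j := by
  simp only [Nat.testBit_eq_decide_div_mod_eq]
  have h1 : N % 2 ^ j < 2 ^ j := Nat.mod_lt _ (by positivity)
  have h2 : 0 < 2 ^ j := by positivity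
  have h3 := Nat.div_add_mod N (2 ^ j)
  split_ifs with h
  · have : (N + 1) / 2 ^ j = N / 2 ^ j + 1 := by
      have : N + 1 = 2 ^ j * (N / 2 ^ j + 1) := by
        rw [Nat.mul_add]
        omega
      conv_lhs => rw [this]
      rw [Nat.mul_div_cancel_left _ h2]
    rw [this]
    by_cases hh : N / 2 ^ j % 2 = 1
    · rw [decide_eq_true hh]
      simp
      omega
    · rw [decide_eq_false hh]
      simp
      omega
  · have : (N + 1) / 2 ^ j = N / 2 ^ j := by
      rw [Nat.div_eq_iff h2]
      constructor
      · rw [mul_comm]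
        omega
      · rw [mul_comm]
        omega
    rw [this]

/-- The edges of the counter. -/
lemma step_bits (V : ℕ) {x y : ℤ} (hx : 3 ≤ x) (hx2 : x % 2 = 1) (hy : 1 ≤ y) (hy2 : y % 3 = 1) :
    cy V x y = (bt V (x - 1) y && cy V x (y - 1)) ∧
    bt V x y = (if cy V x (y - 1) then !bt V (x - 1) y else bt V (x - 1) y) := by
  obtain ⟨i, rfl⟩ : ∃ i : ℕ, x = 2 * i + 3 := ⟨((x - 3) / 2).toNat, by omega⟩
  obtain ⟨j, rfl⟩ : ∃ j : ℕ, y = 3 * j + 1 := ⟨((y - 1) / 3).toNat, by omega⟩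
  have e1 : ((2 * i + 3 - 2 : ℤ) / 2).toNat = i := by omega
  have e2 : ((3 * j + 1 + 2 : ℤ) / 3).toNat = j + 1 := by omega
  have e3 : ((3 * j + 1 - 1 + 2 : ℤ) / 3).toNat = j := by omega
  have e4 : ((2 * i + 3 - 1 : ℤ) / 2).toNat = i + 1 := by omega
  have e5 : ((2 * i + 3 - 1 - 1 : ℤ) / 2).toNat = i := by omega
  have e6 : ((3 * j + 1 - 1 : ℤ) / 3).toNat = j := by omega
  unfold cy bt
  rw [e1, e2, e3, e4, e5, e6]
  constructor
  · rw [Bool.eq_iff_iff]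
    simp [carry_succ]
  · rw [← Nat.add_assoc, bit_succ]
    simp

lemma cy_zero (V : ℕ) (x : ℤ) : cy V x 0 = true := by
  unfold cy
  simp [Nat.mod_one]

lemma cy_same (V : ℕ) (x : ℤ) {y : ℤ} (h : y % 3 ≠ 1) : cy V x (y - 1) = cy V x y := by
  unfold cy
  have : (y - 1 + 2) / 3 = (y + 2) / 3 := by omega
  rw [this]

lemma bt_same (V : ℕ) {x : ℤ} (y : ℤ) (h : x % 2 = 0) : bt V (x - 1) y = bt V x y := by
  unfold bt
  have : (x - 1 - 1) / 2 = (x - 1) / 2 := by omega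
  rw [this]

lemma cy_top (V k m : ℕ) (hm : 1 ≤ m) (hm2 : m ≤ 2 ^ k) (hV : V = 2 ^ (k + 1) - m) {x : ℤ}
    (hx : 3 ≤ x) (hx1 : x ≤ 2 * m + 1) (hx2 : x % 2 = 1) :
    cy V x (3 * k + 3 - 1) = decide (x = 2 * m + 1) := by
  obtain ⟨i, rfl⟩ : ∃ i : ℕ, x = 2 * i + 3 := ⟨((x - 3) / 2).toNat, by omega⟩
  have e1 : ((2 * i + 3 - 2 : ℤ) / 2).toNat = i := by omega
  have e2 : ((3 * k + 3 - 1 + 2 : ℤ) / 3).toNat = k + 1 := by omega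
  unfold cy
  rw [e1, e2, pow_succ] at *
  rw [Nat.mod_eq_of_lt (by omega)]
  apply decide_eq_decide.2
  omega

lemma bt_end (V k m : ℕ) (hm : 1 ≤ m) (hm2 : m ≤ 2 ^ k) (hV : V = 2 ^ (k + 1) - m) {y : ℤ}
    (hy2 : y ≤ 3 * k + 2) : bt V (2 * m + 1) y = false := by
  have e1 : ((2 * m + 1 - 1 : ℤ) / 2).toNat = m := by omega
  unfold bt
  have h : V + m = 2 ^ (k + 1) := by rw [pow_succ] at *; omega
  rw [e1, h]
  apply Nat.testBit_two_pow_of_ne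
  omega

def InSq (k m : ℕ) (p : ℤ × ℤ) : Prop :=
  -2 ≤ p.1 ∧ p.1 ≤ 2 * m + 2 + (3 * k + 4) ∧ 0 ≤ p.2 ∧ p.2 ≤ 3 * k + 3 + (2 * m + 5)

instance (k m : ℕ) (p : ℤ × ℤ) : Decidable (InSq k m p) := by
  unfold InSq
  infer_instance

def Old (k : ℕ) (p : ℤ × ℤ) : Prop :=
  -2 ≤ p.1 ∧ p.1 ≤ 1 ∧ 0 ≤ p.2 ∧ p.2 ≤ 3 * k + 3 ∧ ¬ (p.1 = 1 ∧ p.2 = 3 * k + 3)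

lemma hE_N (V k m : ℕ) {x y : ℤ} (h : 3 * k + 3 < y) : hE V k m x y =
    if y - (3 * k + 3) - 1 < 2 * m + 2 - x - 1 then 36
    else if 2 * m + 2 - x - 1 = y - (3 * k + 3) - 1 then 37 else 35 := by
  unfold hE
  rw [if_pos h]

lemma hE_E (V k m : ℕ) {x y : ℤ} (h : y ≤ 3 * k + 3) (h' : 2 * m + 2 ≤ x) : hE V k m x y =
    if 3 * k + 3 - y = x - (2 * m + 2) then 33
    else if x - (2 * m + 2) < 3 * k + 3 - y then 32 else 34 := by
  unfold hE
  rw [if_neg (by omega), if_pos h']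

lemma vE_E (V k m : ℕ) {x y : ℤ} (h : 2 * m + 2 < x) : vE V k m x y =
    if x - (2 * m + 2) < 3 * k + 3 - y then 40
    else if 3 * k + 3 - y = x - (2 * m + 2) then 41 else 47 := by
  unfold vE
  rw [if_pos h]

lemma vE_N (V k m : ℕ) {x y : ℤ} (h : x ≤ 2 * m + 2) (h' : 3 * k + 3 ≤ y) : vE V k m x y =
    if y - (3 * k + 3) < 2 * m + 2 - x then 44
    else if 2 * m + 2 - x = y - (3 * k + 3) then 45 else 46 := by
  unfold vE
  rw [if_neg (by omega), if_pos h']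

lemma tl_mem1 (V k m : ℕ) {x y : ℤ} (h : 2 * m + 2 < x) : tl V k m (x, y) ∈ fTiles := by
  unfold tl
  simp only
  rw [vE_E V k m h, vE_E V k m h]
  by_cases hy : 3 * k + 3 < y
  · rw [hE_N V k m hy, hE_N V k m hy]
    split_ifs <;> first | decide | omega
  · rw [hE_E V k m (by omega) (by omega), hE_E V k m (by omega) (by omega)]
    split_ifs <;> first | decide | omega

lemma tl_mem2 (V k m : ℕ) {x y : ℤ} (h : x ≤ 2 * m + 2) (hy : 3 * k + 3 < y) :
    tl V k m (x, y) ∈ fTiles := by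
  unfold tl
  simp only
  rw [vE_N V k m h (by omega), vE_N V k m h (by omega), hE_N V k m hy, hE_N V k m hy]
  split_ifs <;> first | decide | omega

lemma hE_mid (V k m : ℕ) {x y : ℤ} (hx : 1 ≤ x) (hx2 : x < 2 * m + 2) (hy : 0 < y)
    (hy2 : y < 3 * k + 3) : hE V k m x y =
      if y % 3 = 1 then (if bt V x y then 26 else 25) else 27 := by
  unfold hE
  rw [if_neg (by omega), if_neg (by omega), if_pos (by omega), if_neg (by omega), if_neg (by omega)]

lemma hE_top (V k m : ℕ) {x y : ℤ} (hx : 1 ≤ x) (hx2 : x < 2 * m + 2) (hy : y = 3 * k + 3) :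
    hE V k m x y = if x % 2 = 0 then 29 else if x = 2 * m + 1 then 31 else 24 := by
  unfold hE
  rw [if_neg (by omega), if_neg (by omega), if_pos (by omega), if_pos (by omega)]

lemma hE_bot (V k m : ℕ) {x y : ℤ} (hx : 1 ≤ x) (hx2 : x < 2 * m + 2) (hy : y = 0) :
    hE V k m x y = if x % 2 = 0 then 30 else 28 := by
  unfold hE
  rw [if_neg (by omega), if_neg (by omega), if_pos (by omega), if_neg (by omega), if_pos (by omega)]

lemma vE_odd (V k m : ℕ) {x y : ℤ} (hx : 2 ≤ x) (hx2 : x < 2 * m + 2) (ho : x % 2 = 1)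
    (hy : 0 ≤ y) (hy2 : y < 3 * k + 3) : vE V k m x y = if cy V x y then 43 else 42 := by
  unfold vE
  rw [if_neg (by omega), if_neg (by omega), if_neg (by omega), if_neg (by omega), if_neg (by omega),
    if_neg (by omega)]

lemma vE_even (V k m : ℕ) {x y : ℤ} (hx : 2 ≤ x) (hx2 : x < 2 * m + 2) (ho : x % 2 = 0)
    (hy : 0 ≤ y) (hy2 : y < 3 * k + 3) : vE V k m x y = 38 := by
  unfold vE
  rw [if_neg (by omega), if_neg (by omega), if_neg (by omega), if_neg (by omega), if_neg (by omega),
    if_pos (by omega)]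

lemma vE_end (V k m : ℕ) {x y : ℤ} (hx : x = 2 * m + 2)
    (hy : 0 ≤ y) (hy2 : y < 3 * k + 3) : vE V k m x y = 39 := by
  unfold vE
  rw [if_neg (by omega), if_neg (by omega), if_neg (by omega), if_pos (by omega)]

lemma vE_neg (V k m : ℕ) {x y : ℤ} (hx : x ≤ 2 * m + 2) (hy : y < 0) : vE V k m x y = 0 := by
  unfold vE
  rw [if_neg (by omega), if_neg (by omega), if_pos (by omega)]

lemma vE_top (V k m : ℕ) {x y : ℤ} (hx : x < 2 * m + 2) (hy : y = 3 * k + 3) :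
    vE V k m x y = 44 := by
  unfold vE
  rw [if_neg (by omega), if_pos (by omega), if_pos (by omega)]

lemma hE_end (V k m : ℕ) {x y : ℤ} (hx : x = 2 * m + 2) (hy : y < 3 * k + 3) :
    hE V k m x y = 32 := by
  unfold hE
  rw [if_neg (by omega), if_pos (by omega), if_neg (by omega), if_pos (by omega)]

lemma tl_mem3 (V k m : ℕ) (hm : 1 ≤ m) (hm2 : m ≤ 2 ^ k) (hV : V = 2 ^ (k + 1) - m) {x y : ℤ}
    (h : 2 ≤ x) (h' : x ≤ 2 * m + 2) (hy : 0 ≤ y) (hy' : y ≤ 3 * k + 3) :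
    tl V k m (x, y) ∈ fTiles := by
  unfold tl
  simp only
  by_cases hX : x = 2 * m + 2
  · by_cases hy0 : y = 0
    · rw [vE_end V k m hX hy (by omega), hE_end V k m hX (by omega), vE_neg V k m h' (by omega),
        hE_bot V k m (by omega) (by omega) hy0, if_neg (by omega)]
      decide
    by_cases hyt : y = 3 * k + 3
    · have e1 : vE V k m x y = 45 := by
        unfold vE
        split_ifs <;> omega
      have e2 : hE V k m x y = 33 := by
        unfold hE
        split_ifs <;> omega
      rw [e1, e2, vE_end V k m hX (by omega) (by omega), hE_top V k m (by omega) (by omega) hyt,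
        if_neg (by omega), if_pos (by omega)]
      decide
    · rw [vE_end V k m hX (by omega) (by omega), vE_end V k m hX (by omega) (by omega),
        hE_end V k m hX (by omega), hE_mid V k m (by omega) (by omega) (by omega) (by omega),
        show x - 1 = 2 * m + 1 by omega, bt_end V k m hm hm2 hV (by omega)]
      by_cases h3 : y % 3 = 1 <;> simp only [h3] <;> decide
  by_cases he : x % 2 = 0
  · by_cases hy0 : y = 0
    · rw [vE_even V k m (by omega) (by omega) he (by omega) (by omega),
        hE_bot V k m (by omega) (by omega) hy0, vE_neg V k m h' (by omega),
        hE_bot V k m (by omega) (by omega) hy0, if_pos he, if_neg (by omega)]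
      decide
    by_cases hyt : y = 3 * k + 3
    · rw [vE_top V k m (by omega) hyt,
        vE_even V k m (by omega) (by omega) he (by omega) (by omega), hE_top V k m (by omega) (by omega) hyt,
        hE_top V k m (by omega) (by omega) hyt, if_pos he, if_neg (by omega), if_neg (by omega)]
      decide
    · rw [vE_even V k m (by omega) (by omega) he (by omega) (by omega),
        vE_even V k m (by omega) (by omega) he (by omega) (by omega),
        hE_mid V k m (by omega) (by omega) (by omega) (by omega),
        hE_mid V k m (by omega) (by omega) (by omega) (by omega), bt_same V y he]
      split_ifs <;> decide
  · have ho : x % 2 = 1 := by omega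
    by_cases hy0 : y = 0
    · rw [vE_odd V k m (by omega) (by omega) ho (by omega) (by omega),
        (by rw [hy0]; exact cy_zero V x : cy V x y = true), hE_bot V k m (by omega) (by omega) hy0, vE_neg V k m h' (by omega),
        hE_bot V k m (by omega) (by omega) hy0, if_neg he, if_pos (show (x - 1) % 2 = 0 by omega)]
      decide
    by_cases hyt : y = 3 * k + 3
    · rw [vE_top V k m (by omega) hyt,
        vE_odd V k m (by omega) (by omega) ho (by omega) (by omega), hE_top V k m (by omega) (by omega) hyt,
        hE_top V k m (by omega) (by omega) hyt, if_neg he, if_pos (show (x - 1) % 2 = 0 by omega), hyt,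
        cy_top V k m hm hm2 hV (by omega) (by omega) ho]
      by_cases hl : x = 2 * m + 1
      · rw [decide_eq_true hl, if_pos hl]
        decide
      · rw [decide_eq_false hl, if_neg hl]
        decide
    · rw [vE_odd V k m (by omega) (by omega) ho (by omega) (by omega),
        vE_odd V k m (by omega) (by omega) ho (by omega) (by omega),
        hE_mid V k m (by omega) (by omega) (by omega) (by omega),
        hE_mid V k m (by omega) (by omega) (by omega) (by omega)]
      by_cases h3 : y % 3 = 1
      · obtain ⟨a, b⟩ := step_bits V (by omega : 3 ≤ x) ho (by omega) h3
        rw [a, b, if_pos h3, if_pos h3]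
        cases bt V (x - 1) y <;> cases cy V x (y - 1) <;> decide
      · rw [cy_same V x h3, if_neg h3, if_neg h3]
        cases cy V x y <;> decide

lemma tl_corner (V k m : ℕ) (hm : 1 ≤ m) :
    tl V k m (1, 3 * k + 3) = ⟨44, 24, 0, 23⟩ := by
  simp only [tl, Tile.mk.injEq]
  refine ⟨vE_top V k m (by omega) rfl, ?_, ?_, ?_⟩
  · rw [hE_top V k m (by omega) (by omega) rfl, if_neg (by omega), if_neg (by omega)]
  · unfold vE
    rw [if_neg (by omega), if_neg (by omega), if_neg (by omega), if_neg (by omega),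
      if_pos (by omega)]
  · unfold hE
    rw [if_neg (by omega), if_neg (by omega), if_neg (by omega), if_pos ⟨by omega, by omega⟩]

lemma tl_mem (V k m : ℕ) (hm : 1 ≤ m) (hm2 : m ≤ 2 ^ k) (hV : V = 2 ^ (k + 1) - m) {p : ℤ × ℤ}
    (h : InSq k m p) (h' : ¬ Old k p) : tl V k m p ∈ fTiles := by
  obtain ⟨x, y⟩ := p
  simp only [InSq, Old] at h h'
  by_cases h1 : 2 * m + 2 < x
  · exact tl_mem1 V k m h1
  by_cases h2 : 3 * k + 3 < y
  · exact tl_mem2 V k m (by omega) h2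
  by_cases h3 : 2 ≤ x
  · exact tl_mem3 V k m hm hm2 hV h3 (by omega) (by omega) (by omega)
  · obtain rfl : x = 1 := by omega
    obtain rfl : y = 3 * k + 3 := by omega
    rw [tl_corner V k m hm]
    decide


instance (k : ℕ) (p : ℤ × ℤ) : Decidable (Old k p) := by
  unfold Old
  infer_instance

abbrev S0 (V k : ℕ) : Config := Tw (wst V k 8 0)

lemma S0_act (V k : ℕ) (x : ℤ) {y : ℤ} (h : 3 * k + 1 ≤ y) (h' : y ≤ 3 * k + 3) :
    S0 V k (x, y) = cell 8 x (y - (3 * k + 1)) := by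
  have := Tw_act V k 8 0 x (r := y - (3 * k + 1)) (by omega)
  rwa [add_sub_cancel] at this

lemma S0_mid (V k : ℕ) (x : ℤ) {y : ℤ} (h : 1 ≤ y) (h' : y ≤ 3 * k) :
    S0 V k (x, y) = cell (fullb V ((y - 1) / 3).toNat) x ((y + 2) % 3) := by
  unfold S0 Tw
  simp only
  rw [wst_mid V k 8 0 (by omega) (by omega)]
  congr 3
  omega

lemma S0_zero (V k : ℕ) (x : ℤ) : S0 V k (x, 0) = cell 6 x 2 := by
  unfold S0 Tw
  simp only
  rw [show ((0 : ℤ) + 2) / 3 = 0 by norm_num, wst_zero]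
  rfl

lemma cell_out {s : ℕ} {x r : ℤ} (h : ¬ (-2 ≤ x ∧ x ≤ 1)) : cell s x r = none := by
  by_contra hc
  exact h (cell_ne hc)

lemma S0_iff (V k : ℕ) (p : ℤ × ℤ) : S0 V k p ≠ none ↔ Old k p := by
  obtain ⟨x, y⟩ := p
  unfold Old
  simp only
  by_cases hx : -2 ≤ x ∧ x ≤ 1
  · obtain ⟨hx1, hx2⟩ := hx
    by_cases h1 : y < 0
    · have : S0 V k (x, y) = none := by
        unfold S0 Tw
        simp only
        by_cases h2 : y ≤ -3
        · rw [wst_neg V k 8 0 (by omega), cell_zero]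
        · rw [show (y + 2) / 3 = 0 by omega, wst_zero]
          have : y = -2 ∨ y = -1 := by omega
          rcases this with rfl | rfl <;> interval_cases x <;> decide
      rw [this]
      simp
      omega
    by_cases h2 : y = 0
    · subst h2
      rw [S0_zero]
      have : cell 6 x 2 ≠ none := by interval_cases x <;> decide
      simp only [this, not_false_eq_true, ne_eq, true_iff]
      omega
    by_cases h3 : y ≤ 3 * k
    · rw [S0_mid V k x (by omega) h3]
      have : cell (fullb V ((y - 1) / 3).toNat) x ((y + 2) % 3) ≠ none := by
        have hr1 : 0 ≤ (y + 2) % 3 := by omega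
        have hr2 : (y + 2) % 3 ≤ 2 := by omega
        generalize (y + 2) % 3 = r at hr1 hr2
        unfold fullb
        split_ifs <;> interval_cases x <;> interval_cases r <;> decide
      simp only [this, not_false_eq_true, ne_eq, true_iff]
      omega
    by_cases h4 : y ≤ 3 * k + 3
    · rw [S0_act V k x (by omega) h4]
      have hr1 : 0 ≤ y - (3 * k + 1) := by omega
      have hr2 : y - (3 * k + 1) ≤ 2 := by omega
      have : cell 8 x (y - (3 * k + 1)) ≠ none ↔ ¬ (x = 1 ∧ y - (3 * k + 1) = 2) := by
        generalize y - (3 * k + 1 : ℤ) = r at hr1 hr2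
        interval_cases x <;> interval_cases r <;> decide
      rw [this]
      omega
    · have : S0 V k (x, y) = none := by
        unfold S0 Tw
        simp only
        by_cases h5 : (y + 2) / 3 = k + 2
        · rw [wst_nxt V k 8 0 h5, cell_zero]
        · rw [wst_hi V k 8 0 (by omega), cell_zero]
      rw [this]
      simp
      omega
  · have : S0 V k (x, y) = none := cell_out hx
    rw [this]
    simp
    omega

lemma faceE (V k m : ℕ) (hm : 1 ≤ m) (hb : V.testBit k = true) {y : ℤ} (h : 0 ≤ y)
    (h' : y < 3 * k + 3) : face (S0 V k (1, y)) .E = hE V k m 1 y := by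
  by_cases h2 : y = 0
  · subst h2
    rw [S0_zero, hE_bot V k m (by omega) (by omega) rfl]
    decide
  rw [hE_mid V k m (by omega) (by omega) (by omega) h']
  by_cases h3 : y ≤ 3 * k
  · rw [S0_mid V k 1 (by omega) h3]
    have hbt : bt V 1 y = V.testBit ((y - 1) / 3).toNat := by simp [bt]
    rw [hbt]
    unfold fullb
    have : (y + 2) % 3 = 0 ∧ y % 3 = 1 ∨ (y + 2) % 3 = 1 ∧ ¬ y % 3 = 1 ∨
      (y + 2) % 3 = 2 ∧ ¬ y % 3 = 1 := by omega
    rcases this with ⟨e1, e2⟩ | ⟨e1, e2⟩ | ⟨e1, e2⟩ <;> simp only [e1, e2] <;>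
      cases V.testBit ((y - 1) / 3).toNat <;> decide
  · have : y = 3 * k + 1 ∨ y = 3 * k + 2 := by omega
    rcases this with rfl | rfl
    · rw [S0_act V k 1 (by omega) (by omega), if_pos (by omega)]
      have : bt V 1 (3 * k + 1) = true := by
        rw [← hb]
        simp [bt]
      rw [this, sub_self]
      decide
    · rw [S0_act V k 1 (by omega) (by omega), if_neg (by omega),
        show (3 * k + 2 - (3 * k + 1) : ℤ) = 1 by ring]
      decide

lemma faceT (V k : ℕ) : face (S0 V k (0, 3 * k + 3)) .E = 23 := by
  rw [S0_act V k 0 (by omega) (by omega), show (3 * k + 3 - (3 * k + 1) : ℤ) = 2 by ring]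
  decide

lemma faceN (V k : ℕ) {x : ℤ} (h : -2 ≤ x) (h' : x ≤ 0) : face (S0 V k (x, 3 * k + 3)) .N = 44 := by
  rw [S0_act V k x (by omega) (by omega), show (3 * k + 3 - (3 * k + 1) : ℤ) = 2 by ring]
  interval_cases x <;> decide

lemma faceF (V k : ℕ) : face (S0 V k (1, 3 * k + 2)) .N = 0 := by
  rw [S0_act V k 1 (by omega) (by omega), show (3 * k + 2 - (3 * k + 1) : ℤ) = 1 by ring]
  decide

lemma faceS (V k : ℕ) (x : ℤ) : face (S0 V k (x, 0)) .S = 0 := by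
  rw [S0_zero]
  by_cases h : -2 ≤ x ∧ x ≤ 1
  · obtain ⟨h1, h2⟩ := h
    interval_cases x <;> decide
  · rw [cell_out h]
    rfl

lemma faceW (V k : ℕ) {y : ℤ} (h : 0 ≤ y) (h' : y ≤ 3 * k + 3) :
    face (S0 V k (-2, y)) .W = 0 := by
  by_cases h2 : y = 0
  · subst h2
    rw [S0_zero]
    decide
  by_cases h3 : y ≤ 3 * k
  · rw [S0_mid V k (-2) (by omega) h3]
    have hr1 : 0 ≤ (y + 2) % 3 := by omega
    have hr2 : (y + 2) % 3 ≤ 2 := by omega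
    generalize (y + 2) % 3 = r at hr1 hr2
    unfold fullb
    split_ifs <;> interval_cases r <;> decide
  · rw [S0_act V k (-2) (by omega) h']
    have hr1 : 0 ≤ y - (3 * k + 1) := by omega
    have hr2 : y - (3 * k + 1) ≤ 2 := by omega
    generalize y - (3 * k + 1 : ℤ) = r at hr1 hr2
    interval_cases r <;> decide

def FR (V k m : ℕ) : Config := fun p =>
  if InSq k m p ∧ ¬ Old k p then some (tl V k m p) else S0 V k p

lemma FR_new {V k m : ℕ} {p : ℤ × ℤ} (h : InSq k m p) (h' : ¬ Old k p) :
    FR V k m p = some (tl V k m p) := if_pos ⟨h, h'⟩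

lemma FR_old {V k m : ℕ} {p : ℤ × ℤ} (h' : Old k p) : FR V k m p = S0 V k p :=
  if_neg fun h => h.2 h'

lemma Old.inSq {k : ℕ} (m : ℕ) {p : ℤ × ℤ} (h : Old k p) : InSq k m p := by
  unfold Old at h
  unfold InSq
  omega

lemma S0_none {V k : ℕ} {p : ℤ × ℤ} (h : ¬ Old k p) : S0 V k p = none := by
  by_contra hc
  exact h ((S0_iff V k p).1 hc)

lemma FR_out {V k m : ℕ} {p : ℤ × ℤ} (h : ¬ InSq k m p) : FR V k m p = none := by
  unfold FR
  rw [if_neg fun h' => h h'.1]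
  exact S0_none fun h' => h (h'.inSq m)

lemma FR_ne {V k m : ℕ} {p : ℤ × ℤ} : FR V k m p ≠ none ↔ InSq k m p := by
  constructor
  · intro h
    by_contra hc
    exact h (FR_out hc)
  · intro h
    by_cases h' : Old k p
    · rw [FR_old h']
      exact (S0_iff V k p).2 h'
    · rw [FR_new h h']
      simp

/-! ### Ranks -/

def ra (k m : ℕ) (p : ℤ × ℤ) : ℤ :=
  if p.1 ≤ 2 * m + 2 ∧ p.2 ≤ 3 * k + 3 then 0
  else if 2 * m + 2 < p.1 ∧ 3 * k + 3 < p.2 then 2 else 1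

def rb (k m : ℕ) (p : ℤ × ℤ) : ℤ :=
  if p.1 ≤ 2 * m + 2 ∧ 3 * k + 3 < p.2 then p.2 else p.1

def rc (k m : ℕ) (p : ℤ × ℤ) : ℤ :=
  if p.1 ≤ 2 * m + 2 ∧ p.2 ≤ 3 * k + 3 then (if p.1 % 2 = 0 then - p.2 else p.2)
  else if 2 * m + 2 < p.1 ∧ 3 * k + 3 < p.2 then p.2
  else if 2 * m + 2 < p.1 then
    max (p.1 - (2 * m + 3) - (3 * k + 3 - p.2)) (3 * k + 3 - p.2 - (p.1 - (2 * m + 3)))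
  else max (2 * m + 2 - p.1 - (p.2 - (3 * k + 4))) (p.2 - (3 * k + 4) - (2 * m + 2 - p.1))

def rk (k m : ℕ) (p : ℤ × ℤ) : ℤ ×ₗ ℤ ×ₗ ℤ := toLex (ra k m p, toLex (rb k m p, rc k m p))

lemma rk_lt {k m : ℕ} {p q : ℤ × ℤ} (h : ra k m p < ra k m q ∨ ra k m p = ra k m q ∧
    (rb k m p < rb k m q ∨ rb k m p = rb k m q ∧ rc k m p < rc k m q)) : rk k m p < rk k m q := by
  unfold rk
  rw [Prod.Lex.toLex_lt_toLex, Prod.Lex.toLex_lt_toLex]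
  exact h

lemma rqN {V k m : ℕ} {x y : ℤ} (h : 38 ≤ vE V k m x y ∧ vE V k m x y ≤ 41) :
    2 * m + 2 < x ∧ x - (2 * m + 2) ≤ 3 * k + 3 - y ∨
    0 ≤ y ∧ y < 3 * k + 3 ∧ 2 ≤ x ∧ x ≤ 2 * m + 2 ∧ x % 2 = 0 := by
  unfold vE at h
  split_ifs at h <;> omega

lemma rqS {V k m : ℕ} {x y : ℤ} (h : 42 ≤ vE V k m x y) :
    2 * m + 2 < x ∧ 3 * k + 3 - y < x - (2 * m + 2) ∨ x ≤ 2 * m + 2 ∧ 3 * k + 3 ≤ y ∨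
    0 ≤ y ∧ y < 3 * k + 3 ∧ 2 ≤ x ∧ x < 2 * m + 2 ∧ x % 2 = 1 := by
  unfold vE at h
  split_ifs at h <;> omega

lemma rqW' {V k m : ℕ} {x y : ℤ} (h : 23 ≤ hE V k m x y ∧ hE V k m x y ≤ 35) :
    3 * k + 3 < y ∧ 2 * m + 2 - x < y - (3 * k + 3) ∨ y ≤ 3 * k + 3 ∧ 1 ≤ x ∨
    x = 0 ∧ y = 3 * k + 3 := by
  unfold hE at h
  split_ifs at h <;> omega

lemma rqE {V k m : ℕ} {x y : ℤ} (h : 36 ≤ hE V k m x y) :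
    3 * k + 3 < y ∧ y - (3 * k + 3) ≤ 2 * m + 2 - x := by
  unfold hE at h
  split_ifs at h <;> omega

lemma need (V k m : ℕ) {p : ℤ × ℤ} (h : InSq k m p) (h' : ¬ Old k p) (d : Dir)
    (hd : rqF (tl V k m p) d = true) :
    InSq k m (nb p d) ∧ (Old k (nb p d) ∨ rk k m (nb p d) < rk k m p) := by
  obtain ⟨x, y⟩ := p
  by_cases ho : Old k (nb (x, y) d)
  · exact ⟨ho.inSq m, Or.inl ho⟩
  suffices hs : InSq k m (nb (x, y) d) ∧ (ra k m (nb (x, y) d) < ra k m (x, y) ∨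
      ra k m (nb (x, y) d) = ra k m (x, y) ∧
      (rb k m (nb (x, y) d) < rb k m (x, y) ∨ rb k m (nb (x, y) d) = rb k m (x, y) ∧
        rc k m (nb (x, y) d) < rc k m (x, y))) from ⟨hs.1, Or.inr (rk_lt hs.2)⟩
  simp only [InSq, Old] at h h'
  cases d
  · have hd := rqN (of_decide_eq_true hd)
    simp only [nb, Old] at ho
    simp only [InSq, nb, ra, rb, rc] at hd ⊢
    refine ⟨by omega, ?_⟩
    rcases hd with hd | hd
    · simp only [show ¬ x ≤ 2 * m + 2 by omega, show 2 * m + 2 < x by omega,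
        show ¬ 3 * k + 3 < y by omega, show ¬ 3 * k + 3 < y + 1 by omega, if_true, if_false,
        false_and, and_false, true_and]
      omega
    · simp only [show x ≤ 2 * m + 2 by omega, show y ≤ 3 * k + 3 by omega,
        show y + 1 ≤ 3 * k + 3 by omega, show x % 2 = 0 by omega, if_true, true_and]
      split_ifs <;> omega
  · have hd := rqE (of_decide_eq_true hd)
    simp only [nb, Old] at ho
    simp only [InSq, nb, ra, rb, rc] at hd ⊢
    refine ⟨by omega, ?_⟩
    simp only [show x ≤ 2 * m + 2 by omega, show x + 1 ≤ 2 * m + 2 by omega,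
        show 3 * k + 3 < y by omega, show ¬ y ≤ 3 * k + 3 by omega, show ¬ 2 * m + 2 < x by omega,
        show ¬ 2 * m + 2 < x + 1 by omega, if_true, if_false,
        false_and, and_false, true_and]
    omega
  · have hd := rqS (of_decide_eq_true hd)
    simp only [nb, Old] at ho
    simp only [InSq, nb, ra, rb, rc] at hd ⊢
    refine ⟨by omega, ?_⟩
    rcases hd with hd | hd | hd
    · split_ifs <;> omega
    · split_ifs <;> omega
    · simp only [show x ≤ 2 * m + 2 by omega, show y ≤ 3 * k + 3 by omega,
        show y - 1 ≤ 3 * k + 3 by omega, show ¬ x % 2 = 0 by omega, if_true, if_false, true_and]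
      split_ifs <;> omega
  · have hd := rqW' (of_decide_eq_true hd)
    simp only [nb, Old] at ho
    simp only [InSq, nb, ra, rb, rc] at hd ⊢
    refine ⟨by omega, ?_⟩
    rcases hd with hd | hd | hd
    · split_ifs <;> omega
    · split_ifs <;> omega
    · omega


/-! ### The exposed glues -/

lemma share (V k m : ℕ) (p : ℤ × ℤ) (d : Dir) :
    side (tl V k m (nb p d)) (opp d) = side (tl V k m p) d := by
  obtain ⟨x, y⟩ := p
  cases d <;> simp [nb, opp, side, tl]

lemma rqF_N (t : Tile) : rqF t .N = true ↔ 38 ≤ t.north ∧ t.north ≤ 41 := decide_eq_true_iff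
lemma rqF_S (t : Tile) : rqF t .S = true ↔ 42 ≤ t.south := decide_eq_true_iff
lemma rqF_W (t : Tile) : rqF t .W = true ↔ 23 ≤ t.west ∧ t.west ≤ 35 := decide_eq_true_iff
lemma rqF_E (t : Tile) : rqF t .E = true ↔ 36 ≤ t.east := decide_eq_true_iff

lemma aux1 (g : ℕ) (h : g = 0 ∨ 38 ≤ g ∧ g ≤ 47) : g = 0 ∨ (38 ≤ g ∧ g ≤ 41 ↔ ¬ 42 ≤ g) := by
  omega

lemma aux2 (g : ℕ) (h : g = 0 ∨ 38 ≤ g ∧ g ≤ 47) : g = 0 ∨ (42 ≤ g ↔ ¬ (38 ≤ g ∧ g ≤ 41)) := by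
  omega

lemma aux3 (g : ℕ) (h : g = 0 ∨ 23 ≤ g ∧ g ≤ 37) : g = 0 ∨ (23 ≤ g ∧ g ≤ 35 ↔ ¬ 36 ≤ g) := by
  omega

lemma aux4 (g : ℕ) (h : g = 0 ∨ 23 ≤ g ∧ g ≤ 37) : g = 0 ∨ (36 ≤ g ↔ ¬ (23 ≤ g ∧ g ≤ 35)) := by
  omega

lemma rq_share (V k m : ℕ) (p : ℤ × ℤ) (d : Dir) :
    side (tl V k m p) d = 0 ∨
      (rqF (tl V k m p) d = true ↔ ¬ rqF (tl V k m (nb p d)) (opp d) = true) := by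
  have hs := share V k m p d
  obtain ⟨x, y⟩ := p
  cases d <;> simp only [opp, side] at hs ⊢ <;> simp only [rqF_N, rqF_E, rqF_S, rqF_W, hs]
  · exact aux1 _ (vE_range V k m x y)
  · exact aux4 _ (hE_range V k m x y)
  · exact aux2 _ (vE_range V k m x (y - 1))
  · exact aux3 _ (hE_range V k m (x - 1) y)

lemma quad_old {V k m : ℕ} {p : ℤ × ℤ} {d : Dir} (h : Old k (nb p d)) :
    quad (S0 V k) (FR V k m) rqF p d = face (S0 V k (nb p d)) (opp d) := by
  rw [quad_eq, FR_old h]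
  obtain ⟨u, hu⟩ := Option.ne_none_iff_exists'.1 ((S0_iff V k _).2 h)
  rw [hu]
  rfl

lemma quad_new {V k m : ℕ} {p : ℤ × ℤ} {d : Dir} (h : InSq k m (nb p d)) (h' : ¬ Old k (nb p d)) :
    quad (S0 V k) (FR V k m) rqF p d =
      if rqF (tl V k m (nb p d)) (opp d) = true then 0 else side (tl V k m p) d := by
  rw [quad_eq, FR_new h h', S0_none h', ← share]
  simp [quadL]

lemma quad_out {V k m : ℕ} {p : ℤ × ℤ} {d : Dir} (h : ¬ InSq k m (nb p d)) :
    quad (S0 V k) (FR V k m) rqF p d = 0 := by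
  rw [quad_eq, FR_out h]
  rfl

lemma quad_in (V k m : ℕ) (hm : 1 ≤ m) (hb : V.testBit k = true) {p : ℤ × ℤ} (h : InSq k m p)
    (h' : ¬ Old k p) (d : Dir) : quad (S0 V k) (FR V k m) rqF p d =
      if rqF (tl V k m p) d = true then side (tl V k m p) d else 0 := by
  by_cases ho : Old k (nb p d)
  · rw [quad_old ho]
    obtain ⟨x, y⟩ := p
    cases d
    · exfalso
      simp only [Old, InSq, nb] at h h' ho
      omega
    · exfalso
      simp only [Old, InSq, nb] at h h' ho
      omega
    · simp only [Old, InSq, nb] at h h' ho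
      change face (S0 V k (x, y - 1)) .N = if decide (42 ≤ vE V k m x (y - 1)) = true then
        vE V k m x (y - 1) else 0
      by_cases hx : x = 1
      · obtain rfl := hx
        have hy : y - 1 = 3 * k + 2 := by omega
        have hv : vE V k m 1 (3 * k + 2) = 0 := by
          unfold vE
          split_ifs <;> omega
        rw [hy, faceF, hv]
        rfl
      · have hy : y - 1 = 3 * k + 3 := by omega
        rw [hy, faceN V k (by omega) (by omega), vE_top V k m (by omega) rfl]
        rfl
    · simp only [Old, InSq, nb] at h h' ho
      change face (S0 V k (x - 1, y)) .E = if decide (23 ≤ hE V k m (x - 1) y ∧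
        hE V k m (x - 1) y ≤ 35) = true then hE V k m (x - 1) y else 0
      by_cases hx : x = 1
      · obtain rfl := hx
        have hy : y = 3 * k + 3 := by omega
        have hv : hE V k m 0 (3 * k + 3) = 23 := by
          unfold hE
          split_ifs <;> omega
        rw [hy, sub_self, faceT, hv]
        rfl
      · obtain rfl : x = 2 := by omega
        rw [show (2 - 1 : ℤ) = 1 by norm_num, faceE V k m hm hb (by omega) (by omega)]
        have hv : 23 ≤ hE V k m 1 y ∧ hE V k m 1 y ≤ 35 := by
          unfold hE
          split_ifs <;> omega
        rw [decide_eq_true hv, if_pos rfl]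
  by_cases hi : InSq k m (nb p d)
  · rw [quad_new hi ho]
    rcases rq_share V k m p d with hz | hz
    · rw [hz]
      simp
    · simp only [hz, ite_not]
  · rw [quad_out hi, if_neg]
    intro hd
    exact hi (need V k m h h' d hd).1

lemma G_quad_out (V k m : ℕ) {p : ℤ × ℤ} (h : ¬ InSq k m p) (d : Dir) :
    G (quad (S0 V k) (FR V k m) rqF p d) ≤ 1 := by
  by_cases ho : Old k (nb p d)
  · rw [quad_old ho]
    obtain ⟨x, y⟩ := p
    cases d <;> simp only [Old, InSq, nb] at h ho
    · simp only [nb, opp]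
      rw [show y + 1 = 0 by omega, faceS]
      decide
    · simp only [nb, opp]
      rw [show x + 1 = -2 by omega, faceW V k (by omega) (by omega)]
      decide
    · omega
    · omega
  by_cases hi : InSq k m (nb p d)
  · rw [quad_new hi ho]
    split_ifs with hc
    · decide
    clear hc
    obtain ⟨x, y⟩ := p
    cases d <;> simp only [Old, InSq, nb] at h ho hi <;> simp only [tl, side]
    · unfold vE
      split_ifs <;> first | decide | omega
    · rw [hE_N V k m (by omega)]
      split_ifs <;> first | decide | omega
    · by_cases hx : x ≤ 2 * m + 2
      · rw [vE_N V k m hx (by omega)]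
        split_ifs <;> first | decide | omega
      · rw [vE_E V k m (by omega)]
        split_ifs <;> first | decide | omega
    · by_cases hy : 3 * k + 3 < y
      · rw [hE_N V k m hy]
        split_ifs <;> first | decide | omega
      · rw [hE_E V k m (by omega) (by omega)]
        split_ifs <;> first | decide | omega
  · rw [quad_out hi]
    decide

lemma bond_le (g h : ℕ) : bond G g h ≤ G h := by
  unfold bond
  split_ifs with e
  · rw [e]
  · exact Nat.zero_le _

lemma quad_ext (V k m : ℕ) {p : ℤ × ℤ} (h : ¬ InSq k m p) (t : Tile) :
    sum4 (fun d => bond G (side t d) (quad (S0 V k) (FR V k m) rqF p d)) < 2 := by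
  have h1 : ∀ d, bond G (side t d) (quad (S0 V k) (FR V k m) rqF p d) ≤ 1 :=
    fun d => (bond_le _ _).trans (G_quad_out V k m h d)
  have h2 : ∀ d, ¬ InSq k m (nb p d) →
      bond G (side t d) (quad (S0 V k) (FR V k m) rqF p d) = 0 := by
    intro d hd
    rw [quad_out hd, bond_zero G0]
  have n1 := h1 .N
  have n2 := h1 .E
  have n3 := h1 .S
  have n4 := h1 .W
  have m1 := h2 .N
  have m2 := h2 .E
  have m3 := h2 .S
  have m4 := h2 .W
  simp only [sum4]
  clear h1 h2
  generalize bond G (side t .N) _ = a1 at *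
  generalize bond G (side t .E) _ = a2 at *
  generalize bond G (side t .S) _ = a3 at *
  generalize bond G (side t .W) _ = a4 at *
  obtain ⟨x, y⟩ := p
  simp only [InSq, nb] at h m1 m2 m3 m4
  by_cases hx : -2 ≤ x ∧ x ≤ 2 * m + 2 + (3 * k + 4)
  · have := m2 (by omega)
    have := m4 (by omega)
    by_cases hy : y < 0
    · have := m3 (by omega)
      omega
    · have := m1 (by omega)
      omega
  · have := m1 (by omega)
    have := m3 (by omega)
    by_cases hx : x < -2
    · have := m4 (by omega)
      omega
    · have := m2 (by omega)
      omega

lemma chkF : ∀ u ∈ fTiles,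
    (∀ t ∈ tiles, 2 ≤ sum4 (fun d => bond G (side t d) (if rqF u d = true then side u d else 0)) →
      u = t) ∧
    2 ≤ sum4 (fun d => if rqF u d = true then G (side u d) else 0) ∧
    ∀ d, rqF u d = true → sum4 (fun e => if e = d then 0 else
      bond G (side u e) (if rqF u e = true then side u e else 0)) < 2 := by
  decide +kernel

lemma fTiles_sub : ∀ u ∈ fTiles, u ∈ tiles := by
  intro u hu
  exact List.mem_append_right _ hu

lemma finalPhase (V k m : ℕ) (hm : 1 ≤ m) (hm2 : m ≤ 2 ^ k) (hV : V = 2 ^ (k + 1) - m)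
    (hb : V.testBit k = true) (hst : Stable G 2 (S0 V k)) :
    PhaseTo (Step T G 2) (S0 V k) (FR V k m) := by
  have new : ∀ p u, S0 V k p = none → FR V k m p = some u →
      InSq k m p ∧ ¬ Old k p ∧ u = tl V k m p ∧ u ∈ fTiles := by
    intro p u hs hr
    have h1 : ¬ Old k p := fun h => (S0_iff V k p).2 h hs
    have h2 : InSq k m p := FR_ne.1 (by rw [hr]; simp)
    have h3 : u = tl V k m p := by
      rw [FR_new h2 h1] at hr
      exact (Option.some.inj hr).symm
    exact ⟨h2, h1, h3, h3 ▸ tl_mem V k m hm hm2 hV h2 h1⟩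
  refine (phaseB G0 rqF (rk k m) (Finset.Icc (-2 : ℤ) (2 * m + 2 + (3 * k + 4)) ×ˢ
    Finset.Icc (0 : ℤ) (3 * k + 3 + (2 * m + 5))) ?_ ?_ hst ?_ ?_ ?_ ?_ ?_).1
  · intro p hp
    exact FR_old ((S0_iff V k p).1 hp)
  · intro p hp
    have := FR_ne.1 hp
    unfold InSq at this
    simp only [Finset.mem_product, Finset.mem_Icc]
    omega
  · intro p u hs hr
    exact mem_T.2 (fTiles_sub _ (new p u hs hr).2.2.2)
  · intro p t hs ht hle
    have h1 : ¬ Old k p := fun h => (S0_iff V k p).2 h hs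
    by_cases h2 : InSq k m p
    · rw [FR_new h2 h1]
      simp only [quad_in V k m hm hb h2 h1] at hle
      rw [(chkF _ (tl_mem V k m hm hm2 hV h2 h1)).1 t (mem_T.1 ht) hle]
    · exact absurd hle (not_le.2 (quad_ext V k m h2 t))
  · intro C p t hSC hCR hcl hp hR ha d hd
    have hs : S0 V k p = none := by
      by_contra hc
      exact hSC.ne hc hp
    obtain ⟨h2, h1, h3, h4⟩ := new p t hs hR
    refine req_of_lt G0 hCR hcl hp ha d ?_
    simp only [quad_in V k m hm hb h2 h1, ← h3]
    exact (chkF _ h4).2.2 d hd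
  · intro p u hs hr
    obtain ⟨h2, h1, h3, h4⟩ := new p u hs hr
    refine (chkF _ h4).2.1.trans (sum4_le fun d => ?_)
    by_cases hd : rqF u d = true
    · rw [if_pos hd, if_pos (Or.inr hd)]
      have hq := quad_in V k m hm hb h2 h1 d
      rw [← h3, if_pos hd, quad_eq] at hq
      have hne : side u d ≠ 0 := by
        intro h0
        revert hd
        cases d <;> simp only [side] at h0 <;> simp [rqF, h0]
      have hf : face (FR V k m (nb p d)) (opp d) = side u d := by
        rw [← hq] at hne ⊢
        revert hne
        unfold quadL face
        cases FR V k m (nb p d) with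
        | none => simp
        | some v =>
          simp only
          split_ifs <;> simp
      rw [hf]
      simp [bond]
    · rw [if_neg hd]
      exact Nat.zero_le _
  · intro p u hs hr d hd
    obtain ⟨h2, h1, h3, h4⟩ := new p u hs hr
    rw [h3] at hd
    obtain ⟨a, b⟩ := need V k m h2 h1 d hd
    refine ⟨FR_ne.2 a, ?_⟩
    rcases b with b | b
    · exact Or.inl ((S0_iff V k _).2 b)
    · exact Or.inr b

lemma mainGood (k m : ℕ) (hm : 1 ≤ m) (hm2 : m ≤ 2 ^ k) :
    Good (Step T G) (10 :: (wtemps (2 ^ (k + 1) - m) 0 k ++ [6, 2])) (seedConfig seed)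
      (FR (2 ^ (k + 1) - m) k m) := by
  have hb : (2 ^ (k + 1) - m).testBit k = true := by
    rw [Nat.testBit_eq_decide_div_mod_eq]
    have : (2 ^ (k + 1) - m) / 2 ^ k = 1 := by
      have : 0 < 2 ^ k := by positivity
      rw [Nat.div_eq_iff this, pow_succ]
      omega
    rw [this]
    rfl
  obtain ⟨a, b⟩ := phase0 (2 ^ (k + 1) - m)
  refine good_cons a (writer _ k 0 _ _ b fun h => ?_)
  rw [zero_add] at h ⊢
  obtain ⟨c, d⟩ := phaseV1 _ k h
  refine good_cons c (good_cons (finalPhase _ k m hm hm2 rfl hb (d.mono (by norm_num))) ?_)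
  exact good_nil _ _


/-! ## Small squares -/

def Gs (g : Glue) : ℕ := if g = 0 then 0 else 1

lemma Gs0 : Gs 0 = 0 := rfl

def gv (n : ℕ) (p : ℤ × ℤ) : ℕ :=
  if p.1 = 0 ∧ 0 ≤ p.2 ∧ p.2 + 1 < n then (64 * p.2 + 1).toNat else 0

def gh (n : ℕ) (p : ℤ × ℤ) : ℕ :=
  if 0 ≤ p.1 ∧ p.1 + 1 < n ∧ 0 ≤ p.2 ∧ p.2 < n then (2 * (p.1 + 32 * p.2) + 2).toNat else 0

def gt (n : ℕ) (p : ℤ × ℤ) : Tile := ⟨gv n p, gh n p, gv n (nb p .S), gh n (nb p .W)⟩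

def GR (n : ℕ) : Config := fun p =>
  if 0 ≤ p.1 ∧ p.1 < (n : ℤ) ∧ 0 ≤ p.2 ∧ p.2 < (n : ℤ) then some (gt n p) else none

def rqG (t : Tile) : Dir → Bool
  | .S => decide (t.south ≠ 0)
  | .W => decide (t.west ≠ 0)
  | _ => false

def gT (n : ℕ) : Finset Tile :=
  (Finset.range n ×ˢ Finset.range n).image fun q => gt n ((q.1 : ℤ), (q.2 : ℤ))

lemma gv_inj {n : ℕ} {p q : ℤ × ℤ} (h : gv n p = gv n q) (h0 : gv n p ≠ 0) : p = q := by
  obtain ⟨x, y⟩ := p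
  obtain ⟨x', y'⟩ := q
  unfold gv at h h0
  simp only [Prod.mk.injEq] at *
  split_ifs at h h0 <;> omega

lemma gh_inj {n : ℕ} (hn : n < 32) {p q : ℤ × ℤ} (h : gh n p = gh n q) (h0 : gh n p ≠ 0) :
    p = q := by
  obtain ⟨x, y⟩ := p
  obtain ⟨x', y'⟩ := q
  unfold gh at h h0
  simp only [Prod.mk.injEq] at *
  split_ifs at h h0 <;> omega

lemma gquad (n : ℕ) (S : Config) (hS : ∀ p, S p ≠ none → p = (0, 0)) (p : ℤ × ℤ) :
    quad S (GR n) rqG p .N = 0 ∧ quad S (GR n) rqG p .E = 0 ∧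
    quad S (GR n) rqG p .S = gv n (nb p .S) ∧ quad S (GR n) rqG p .W = gh n (nb p .W) := by
  simp only [quad_eq]
  refine ⟨?_, ?_, ?_, ?_⟩
  · by_cases hz : gv n p = 0
    · unfold quadL GR
      split_ifs
      · have : side (gt n (nb p .N)) (opp .N) = 0 := by
          rw [← hz]
          change gv n (nb (nb p .N) (opp .N)) = _
          rw [nb_opp]
        simp [this]
      · rfl
    · have hs : S (nb p .N) = none := by
        by_contra hc
        have h2 := hS _ hc
        apply hz
        simp only [nb, Prod.mk.injEq] at h2
        unfold gv
        rw [if_neg (by omega)]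
      rw [hs]
      unfold quadL GR
      split_ifs
      · have : rqG (gt n (nb p .N)) (opp .N) = true := by
          change decide (gv n (nb (nb p .N) (opp .N)) ≠ 0) = true
          rw [nb_opp]
          exact decide_eq_true hz
        simp [this]
      · rfl
  · by_cases hz : gh n p = 0
    · unfold quadL GR
      split_ifs
      · have : side (gt n (nb p .E)) (opp .E) = 0 := by
          rw [← hz]
          change gh n (nb (nb p .E) (opp .E)) = _
          rw [nb_opp]
        simp [this]
      · rfl
    · have hs : S (nb p .E) = none := by
        by_contra hc
        have h2 := hS _ hc
        apply hz
        simp only [nb, Prod.mk.injEq] at h2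
        unfold gh
        rw [if_neg (by omega)]
      rw [hs]
      unfold quadL GR
      split_ifs
      · have : rqG (gt n (nb p .E)) (opp .E) = true := by
          change decide (gh n (nb (nb p .E) (opp .E)) ≠ 0) = true
          rw [nb_opp]
          exact decide_eq_true hz
        simp [this]
      · rfl
  · unfold quadL GR
    split_ifs with h
    · simp [rqG, opp, side, gt]
    · unfold gv
      rw [if_neg (by omega)]
  · unfold quadL GR
    split_ifs with h
    · simp [rqG, opp, side, gt]
    · unfold gh
      rw [if_neg (by omega)]

lemma bond_pos {g h : ℕ} (hb : bond Gs g h ≠ 0) : g = h ∧ h ≠ 0 := by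
  unfold bond at hb
  split_ifs at hb with e
  · refine ⟨e, ?_⟩
    rintro rfl
    rw [e] at hb
    exact hb rfl
  · exact absurd rfl hb

lemma bond_self {g : ℕ} (h : g ≠ 0) : bond Gs g g = 1 := by
  simp [bond, Gs, h]

lemma GR_some {n : ℕ} {p : ℤ × ℤ} {u : Tile} (h : GR n p = some u) :
    (0 ≤ p.1 ∧ p.1 < (n : ℤ) ∧ 0 ≤ p.2 ∧ p.2 < (n : ℤ)) ∧ u = gt n p := by
  unfold GR at h
  split_ifs at h with hc
  exact ⟨hc, (Option.some.inj h).symm⟩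

lemma gv_S {n : ℕ} {p : ℤ × ℤ} : gv n (nb p .S) ≠ 0 ↔
    p.1 = 0 ∧ 0 ≤ p.2 - 1 ∧ p.2 - 1 + 1 < (n : ℤ) := by
  have h : ∀ q : ℤ × ℤ, gv n q ≠ 0 ↔ q.1 = 0 ∧ 0 ≤ q.2 ∧ q.2 + 1 < (n : ℤ) := by
    intro q
    unfold gv
    split_ifs <;> omega
  exact h _

lemma gh_W {n : ℕ} {p : ℤ × ℤ} : gh n (nb p .W) ≠ 0 ↔
    0 ≤ p.1 - 1 ∧ p.1 - 1 + 1 < (n : ℤ) ∧ 0 ≤ p.2 ∧ p.2 < (n : ℤ) := by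
  have h : ∀ q : ℤ × ℤ, gh n q ≠ 0 ↔
      0 ≤ q.1 ∧ q.1 + 1 < (n : ℤ) ∧ 0 ≤ q.2 ∧ q.2 < (n : ℤ) := by
    intro q
    unfold gh
    split_ifs <;> omega
  exact h _

lemma gS_zero {n : ℕ} {p : ℤ × ℤ} (h : gh n (nb p .W) ≠ 0) : gv n (nb p .S) = 0 := by
  by_contra hc
  have h1 := gv_S.1 hc
  have h2 := gh_W.1 h
  omega

lemma smallPhase (n : ℕ) (hn1 : 1 ≤ n) (hn : n < 32) :
    PhaseTo (Step (gT n) Gs 1) (seedConfig (gt n (0, 0))) (GR n) := by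
  have hS : ∀ p, seedConfig (gt n (0, 0)) p ≠ none → p = (0, 0) := by
    intro p hp
    by_contra hc
    exact hp (if_neg hc)
  have hS' : ∀ p, seedConfig (gt n (0, 0)) p = none → p ≠ (0, 0) := by
    rintro p hp rfl
    simp [seedConfig] at hp
  have sq := gquad n _ hS
  refine (phaseB Gs0 rqG (fun p => p.1 + p.2) (Finset.Ico (0 : ℤ) n ×ˢ Finset.Ico (0 : ℤ) n)
    ?_ ?_ ?_ ?_ ?_ ?_ ?_ ?_).1
  · intro p hp
    rw [hS p hp]
    unfold GR
    rw [if_pos (by simp; omega)]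
    simp [seedConfig]
  · intro p hp
    obtain ⟨t, ht⟩ := Option.ne_none_iff_exists'.1 hp
    have := (GR_some ht).1
    simp only [Finset.mem_product, Finset.mem_Ico]
    omega
  · intro Q ⟨q, hq⟩ h0 hQ
    exfalso
    have := hS q (hQ q hq)
    rw [this] at hq
    exact h0 hq
  · intro p u _ hr
    obtain ⟨h1, rfl⟩ := GR_some hr
    unfold gT
    rw [Finset.mem_image]
    refine ⟨(p.1.toNat, p.2.toNat), ?_, ?_⟩
    · simp only [Finset.mem_product, Finset.mem_range]
      omega
    · simp only
      rw [Int.toNat_of_nonneg h1.1, Int.toNat_of_nonneg h1.2.2.1]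
  · intro p t _ ht hle
    obtain ⟨⟨a, b⟩, hq, rfl⟩ := Finset.mem_image.1 ht
    simp only [Finset.mem_product, Finset.mem_range] at hq
    obtain ⟨e1, e2, e3, e4⟩ := sq p
    simp only [sum4, e1, e2, e3, e4, bond_zero Gs0] at hle
    have key : ((a : ℤ), (b : ℤ)) = p := by
      by_cases hv : bond Gs (side (gt n ((a : ℤ), (b : ℤ))) .S) (gv n (nb p .S)) = 0
      · rw [hv] at hle
        have hh : bond Gs (side (gt n ((a : ℤ), (b : ℤ))) .W) (gh n (nb p .W)) ≠ 0 := by omega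
        obtain ⟨h1, h2⟩ := bond_pos hh
        have h3 : nb p .W = nb ((a : ℤ), (b : ℤ)) .W := gh_inj hn h1.symm h2
        have h4 := congrArg (fun q => nb q .E) h3
        simpa [nb] using h4.symm
      · obtain ⟨h1, h2⟩ := bond_pos hv
        have h3 : nb p .S = nb ((a : ℤ), (b : ℤ)) .S := gv_inj h1.symm h2
        have h4 := congrArg (fun q => nb q .N) h3
        simpa [nb] using h4.symm
    unfold GR
    rw [← key, if_pos]
    simp only
    omega
  · intro C p t hSC hCR hcl hp hR ha d hd
    obtain ⟨h1, rfl⟩ := GR_some hR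
    refine req_of_lt Gs0 hCR hcl hp ha d ?_
    obtain ⟨e1, e2, e3, e4⟩ := sq p
    cases d
    · cases hd
    · cases hd
    · have hd : gv n (nb p .S) ≠ 0 := of_decide_eq_true hd
      have hz : gh n (nb p .W) = 0 := by
        by_contra hc
        exact hd (gS_zero hc)
      simp [sum4, e1, e2, e4, hz, bond_zero Gs0]
    · have hd : gh n (nb p .W) ≠ 0 := of_decide_eq_true hd
      simp [sum4, e1, e2, e3, gS_zero hd, bond_zero Gs0]
  · intro p u hs hr
    obtain ⟨h1, rfl⟩ := GR_some hr
    have hne := hS' p hs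
    by_cases hx : p.1 = 0
    · have hy : p.2 ≠ 0 := fun hy => hne (Prod.ext hx hy)
      have hv : gv n (nb p .S) ≠ 0 := gv_S.2 (by omega)
      have hr : rqG (gt n p) .S = true := decide_eq_true hv
      have hf : face (GR n (nb p .S)) (opp .S) = gv n (nb p .S) := by
        unfold GR
        rw [if_pos (by simp only [nb]; omega)]
        rfl
      have hb : bond Gs (side (gt n p) .S) (face (GR n (nb p .S)) (opp .S)) = 1 := by
        rw [hf]
        exact bond_self hv
      simp only [sum4]
      rw [if_pos (Or.inr hr), hb]
      omega
    · have hv : gh n (nb p .W) ≠ 0 := gh_W.2 (by omega)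
      have hr : rqG (gt n p) .W = true := decide_eq_true hv
      have hf : face (GR n (nb p .W)) (opp .W) = gh n (nb p .W) := by
        unfold GR
        rw [if_pos (by simp only [nb]; omega)]
        rfl
      have hb : bond Gs (side (gt n p) .W) (face (GR n (nb p .W)) (opp .W)) = 1 := by
        rw [hf]
        exact bond_self hv
      simp only [sum4]
      rw [if_pos (c := _ ∨ rqG (gt n p) .W = true) (Or.inr hr), hb]
      omega
  · intro p u hs hr d hd
    obtain ⟨h1, rfl⟩ := GR_some hr
    cases d
    · cases hd
    · cases hd
    · have hd : gv n (nb p .S) ≠ 0 := of_decide_eq_true hd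
      have hc := gv_S.1 hd
      refine ⟨?_, Or.inr ?_⟩
      · unfold GR
        rw [if_pos (by simp only [nb]; omega)]
        simp
      · simp only [nb]
        omega
    · have hd : gh n (nb p .W) ≠ 0 := of_decide_eq_true hd
      have hc := gh_W.1 hd
      refine ⟨?_, Or.inr ?_⟩
      · unfold GR
        rw [if_pos (by simp only [nb]; omega)]
        simp
      · simp only [nb]
        omega

/-! ## Conclusion -/

lemma params (n : ℕ) (hn : 32 ≤ n) : ∃ k m : ℕ, n = 2 * m + 3 * k + 9 ∧ 1 ≤ m ∧ m ≤ 2 ^ k ∧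
    k ≤ Nat.log 2 n + 1 := by
  have h1 : 2 ^ Nat.log 2 n ≤ n := Nat.pow_log_le_self 2 (by omega)
  have h2 : n < 2 ^ (Nat.log 2 n + 1) := Nat.lt_pow_succ_log_self (by norm_num) n
  have h3 : 5 ≤ Nat.log 2 n := (Nat.le_log_iff_pow_le (by norm_num) (by omega)).2 (by omega)
  generalize Nat.log 2 n = K at *
  have h4 : 3 * K + 14 ≤ 2 ^ K := by
    clear h1 h2
    induction K, h3 using Nat.le_induction with
    | base => norm_num
    | succ j hj ih =>
      rw [pow_succ]
      omega
  rw [pow_succ] at h2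
  by_cases hp : (n + K) % 2 = 1
  · exact ⟨K, (n - 3 * K - 9) / 2, by omega, by omega, by omega, by omega⟩
  · refine ⟨K + 1, (n - 3 * (K + 1) - 9) / 2, by omega, by omega, ?_, by omega⟩
    rw [pow_succ]
    omega

lemma big_shape (V k m n : ℕ) (h : n = 2 * m + 3 * k + 9) :
    shape (FR V k m) = translateSet (-2, 0) (square n) := by
  ext ⟨x, y⟩
  change FR V k m (x, y) ≠ none ↔ _
  rw [FR_ne]
  unfold translateSet square InSq
  constructor
  · intro hh
    refine ⟨(x + 2, y), ?_, ?_⟩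
    · change 0 ≤ x + 2 ∧ x + 2 < (n : ℤ) ∧ 0 ≤ y ∧ y < (n : ℤ)
      simp only at hh
      omega
    · simp
  · rintro ⟨⟨a, b⟩, hab, he⟩
    change 0 ≤ a ∧ a < (n : ℤ) ∧ 0 ≤ b ∧ b < (n : ℤ) at hab
    simp only [Prod.mk_add_mk, Prod.mk.injEq] at he
    simp only
    omega

lemma small_shape (n : ℕ) : shape (GR n) = translateSet (0, 0) (square n) := by
  have : translateSet (0, 0) (square n) = square n := by
    unfold translateSet
    rw [show ((0, 0) : ℤ × ℤ) = 0 from rfl]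
    simp
  rw [this]
  ext p
  change GR n p ≠ none ↔ 0 ≤ p.1 ∧ p.1 < (n : ℤ) ∧ 0 ≤ p.2 ∧ p.2 < (n : ℤ)
  unfold GR
  split_ifs with h
  · simp only [ne_eq, reduceCtorEq, not_false_eq_true, h, and_self]
  · simp only [ne_eq, not_true_eq_false, h]

lemma T_card : T.card ≤ 48 := (List.toFinset_card_le _).trans (by decide)

lemma gT_card {n : ℕ} (hn : n < 32) : (gT n).card ≤ 1000 := by
  refine Finset.card_image_le.trans ?_
  rw [Finset.card_product, Finset.card_range]
  nlinarith

end Sq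

/-- There are constants `c₁, c₂ > 0` and `R ∈ ℕ` such that every `n ≥ 1`
admits a multiple temperature tile system with tile complexity at most `c₁`, temperature
range at most `R`, and temperature complexity at most `c₂ · (log₂ n + 1)` that uniquely
assembles the `n × n` square. -/
theorem stmt3 :
    ∃ (c₁ c₂ : ℝ) (R : ℕ), 0 < c₁ ∧ 0 < c₂ ∧
      ∀ n : ℕ, 1 ≤ n →
        ∃ (T : Finset Tile) (s : Tile) (G : Glue → ℕ) (τs : List ℕ),
          s ∈ T ∧ G 0 = 0 ∧ (∀ τ ∈ τs, 1 ≤ τ ∧ τ ≤ R) ∧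
          (T.card : ℝ) ≤ c₁ ∧ (τs.length : ℝ) ≤ c₂ * (Real.logb 2 n + 1) ∧
          UniquelyAssembles (Step T G) s τs (square n) := by
  refine ⟨1000, 5, 10, by norm_num, by norm_num, fun n hn => ?_⟩
  by_cases hs : n < 32
  · refine ⟨Sq.gT n, Sq.gt n (0, 0), Sq.Gs, [1], ?_, rfl, ?_, ?_, ?_, Sq.GR n, ?_, (0, 0),
      Sq.small_shape n⟩
    · refine Finset.mem_image.2 ⟨(0, 0), ?_, rfl⟩
      simp only [Finset.mem_product, Finset.mem_range]
      omega
    · intro τ hτ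
      rw [List.mem_singleton] at hτ
      omega
    · exact_mod_cast Sq.gT_card hs
    · have : 0 ≤ Real.logb 2 n := Real.logb_nonneg (by norm_num) (by exact_mod_cast hn)
      simp only [List.length_singleton, Nat.cast_one]
      linarith
    · exact good_cons (Sq.smallPhase n hn hs) (good_nil _ _)
  · obtain ⟨k, m, h1, h2, h3, h4⟩ := Sq.params n (by omega)
    refine ⟨Sq.T, Sq.seed, Sq.G, 10 :: (Sq.wtemps (2 ^ (k + 1) - m) 0 k ++ [6, 2]), ?_, rfl, ?_, ?_,
      ?_, Sq.FR (2 ^ (k + 1) - m) k m, Sq.mainGood k m h2 h3, (-2, 0), Sq.big_shape _ k m n h1⟩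
    · exact Sq.mem_T.2 (by decide)
    · intro τ hτ
      simp only [List.mem_cons, List.mem_append, List.not_mem_nil, or_false] at hτ
      rcases hτ with rfl | h | rfl | rfl
      · omega
      · exact Sq.wtemps_mem _ _ _ _ h
      · omega
      · omega
    · have := Sq.T_card
      have h : (Sq.T.card : ℝ) ≤ 48 := by exact_mod_cast this
      linarith
    · have hl := Real.natLog_le_logb n 2
      have h5 : ((k : ℕ) : ℝ) ≤ Nat.log 2 n + 1 := by exact_mod_cast h4
      simp only [List.length_cons, List.length_append, Sq.wtemps_len, List.length_nil]
      push_cast at hl ⊢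
      have h0 : (0 : ℝ) ≤ Nat.log 2 n := Nat.cast_nonneg _
      linarith
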